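/- Let (A, Q) be a relative n-Auslander–Gorenstein pair with pd_A Q = l, id_A Q = m, Ext^{i>0}_A(Q,Q) = 0, and n ≥ m + l + 2. Let Λ = End_A(Q)^op. Then there exists an exact sequence 0 → Q_m → Q_{m−1} → ⋯ → Q_0 → τ_{n−m−1}(Q) → 0 of right Λ-modules which remains exact under Hom_Λ(Q, −), with each Q_i ∈ add(Q_Λ). -/

import Mathlib

universe u
open MulOpposite

noncomputable section
namespace Paper

section RingDefs
variable (B : Type u) [Ring B]

/-- `X` belongs to `add Q`: it is a direct summand of a finite direct sum of copies of `Q`. -/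
def InAdd (Q X : ModuleCat.{u} B) : Prop :=
  ∃ (n : ℕ) (s : X →ₗ[B] (Fin n → Q)) (r : (Fin n → Q) →ₗ[B] X), r ∘ₗ s = LinearMap.id

/-- A superfluous (small) submodule. -/
def Superfluous {P : ModuleCat.{u} B} (N : Submodule B P) : Prop :=
  ∀ K : Submodule B P, K ⊔ N = ⊤ → K = ⊤

/-- An essential (large) submodule. -/
def Essential {P : ModuleCat.{u} B} (N : Submodule B P) : Prop :=
  ∀ K : Submodule B P, K ⊓ N = ⊥ → K = ⊥

/-- `p : P → X` is a projective cover. -/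
def IsProjCover {P X : ModuleCat.{u} B} (p : P →ₗ[B] X) : Prop :=
  Module.Projective B P ∧ Function.Surjective p ∧ Superfluous B (LinearMap.ker p)

/-- `ι : X → I` is an injective envelope. -/
def IsInjEnvelope {X I : ModuleCat.{u} B} (ι : X →ₗ[B] I) : Prop :=
  Module.Injective B I ∧ Function.Injective ι ∧ Essential B (LinearMap.range ι)

/-- The zero module. -/
def zeroMod : ModuleCat.{u} B := ModuleCat.of B PUnit

/-- An exact sequence `0 → P_m → ⋯ → P_1 → P_0 → X → 0` whose terms satisfy the
predicate `T` and which remains exact under `Hom(test, −)`. -/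
def ResLE (test : ModuleCat.{u} B) (T : ModuleCat.{u} B → Prop)
    (X : ModuleCat.{u} B) (m : ℕ) : Prop :=
  ∃ (P : ℕ → ModuleCat.{u} B) (d : ∀ j, P (j+1) →ₗ[B] P j) (aug : P 0 →ₗ[B] X),
    (∀ j, j ≤ m → T (P j)) ∧ (∀ j, m < j → Subsingleton (P j)) ∧
    Function.Surjective aug ∧ Function.Exact (d 0) aug ∧
    (∀ j, Function.Exact (d (j+1)) (d j)) ∧
    (∀ f : test →ₗ[B] X, ∃ h : test →ₗ[B] P 0, aug ∘ₗ h = f) ∧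
    (∀ f : test →ₗ[B] P 0, aug ∘ₗ f = 0 → ∃ h : test →ₗ[B] P 1, d 0 ∘ₗ h = f) ∧
    (∀ j, ∀ f : test →ₗ[B] P (j+1), d j ∘ₗ f = 0 →
      ∃ h : test →ₗ[B] P (j+2), d (j+1) ∘ₗ h = f)

/-- An exact sequence `0 → X → I_0 → ⋯ → I_m → 0` whose terms satisfy the predicate `T`
and which remains exact under `Hom(−, test)`. -/
def CoresLE (test : ModuleCat.{u} B) (T : ModuleCat.{u} B → Prop)
    (X : ModuleCat.{u} B) (m : ℕ) : Prop :=
  ∃ (M : ℕ → ModuleCat.{u} B) (ι : X →ₗ[B] M 0) (d : ∀ j, M j →ₗ[B] M (j+1)),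
    (∀ j, j ≤ m → T (M j)) ∧ (∀ j, m < j → Subsingleton (M j)) ∧
    Function.Injective ι ∧ Function.Exact ι (d 0) ∧
    (∀ j, Function.Exact (d j) (d (j+1))) ∧
    (∀ f : X →ₗ[B] test, ∃ h : M 0 →ₗ[B] test, h ∘ₗ ι = f) ∧
    (∀ f : M 0 →ₗ[B] test, f ∘ₗ ι = 0 → ∃ h : M 1 →ₗ[B] test, h ∘ₗ d 0 = f) ∧
    (∀ j, ∀ f : M (j+1) →ₗ[B] test, f ∘ₗ d j = 0 →
      ∃ h : M (j+2) →ₗ[B] test, h ∘ₗ d (j+1) = f)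

/-- Projective dimension at most `n`. -/
def pdLE (X : ModuleCat.{u} B) (n : ℕ) : Prop :=
  ResLE B (zeroMod B) (fun P => Module.Projective B P) X n

/-- Injective dimension at most `n`. -/
def idLE (X : ModuleCat.{u} B) (n : ℕ) : Prop :=
  CoresLE B (zeroMod B) (fun I => Module.Injective B I) X n

/-- Projective dimension equal to `n`. -/
def pdEq (X : ModuleCat.{u} B) (n : ℕ) : Prop :=
  pdLE B X n ∧ ∀ j, pdLE B X j → n ≤ j

/-- Injective dimension equal to `n`. -/
def idEq (X : ModuleCat.{u} B) (n : ℕ) : Prop :=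
  idLE B X n ∧ ∀ j, idLE B X j → n ≤ j

/-- Projective dimension as an element of `ℕ∞`. -/
def pdDim (X : ModuleCat.{u} B) : ℕ∞ :=
  sInf {c : ℕ∞ | ∃ n : ℕ, c = n ∧ pdLE B X n}

/-- Injective dimension as an element of `ℕ∞`. -/
def idDim (X : ModuleCat.{u} B) : ℕ∞ :=
  sInf {c : ℕ∞ | ∃ n : ℕ, c = n ∧ idLE B X n}

/-- Relative dominant dimension of `X` with respect to `Q` is at least `n`:
there is an exact sequence `0 → X → Q_1 → ⋯ → Q_n` with `Q_i ∈ add Q`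
remaining exact under `Hom(−, Q)`. -/
def domdimGE (Q X : ModuleCat.{u} B) (n : ℕ) : Prop :=
  n = 0 ∨ ∃ (M : ℕ → ModuleCat.{u} B) (ι : X →ₗ[B] M 0) (d : ∀ j, M j →ₗ[B] M (j+1)),
    (∀ j, j + 1 ≤ n → InAdd B Q (M j)) ∧
    Function.Injective ι ∧ (2 ≤ n → Function.Exact ι (d 0)) ∧
    (∀ j, j + 3 ≤ n → Function.Exact (d j) (d (j+1))) ∧
    (∀ f : X →ₗ[B] Q, ∃ h : M 0 →ₗ[B] Q, h ∘ₗ ι = f) ∧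
    (2 ≤ n → ∀ f : M 0 →ₗ[B] Q, f ∘ₗ ι = 0 → ∃ h : M 1 →ₗ[B] Q, h ∘ₗ d 0 = f) ∧
    (∀ j, j + 3 ≤ n → ∀ f : M (j+1) →ₗ[B] Q, f ∘ₗ d j = 0 →
      ∃ h : M (j+2) →ₗ[B] Q, h ∘ₗ d (j+1) = f)

/-- Relative codominant dimension of `X` with respect to `Q` is at least `n`. -/
def codomdimGE (Q X : ModuleCat.{u} B) (n : ℕ) : Prop :=
  n = 0 ∨ ∃ (M : ℕ → ModuleCat.{u} B) (aug : M 0 →ₗ[B] X) (d : ∀ j, M (j+1) →ₗ[B] M j),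
    (∀ j, j + 1 ≤ n → InAdd B Q (M j)) ∧
    Function.Surjective aug ∧ (2 ≤ n → Function.Exact (d 0) aug) ∧
    (∀ j, j + 3 ≤ n → Function.Exact (d (j+1)) (d j)) ∧
    (∀ f : Q →ₗ[B] X, ∃ h : Q →ₗ[B] M 0, aug ∘ₗ h = f) ∧
    (2 ≤ n → ∀ f : Q →ₗ[B] M 0, aug ∘ₗ f = 0 → ∃ h : Q →ₗ[B] M 1, d 0 ∘ₗ h = f) ∧
    (∀ j, j + 3 ≤ n → ∀ f : Q →ₗ[B] M (j+1), d j ∘ₗ f = 0 →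
      ∃ h : Q →ₗ[B] M (j+2), d (j+1) ∘ₗ h = f)

/-- Relative dominant dimension with respect to `Q`, as an element of `ℕ∞`. -/
def relDomDim (Q X : ModuleCat.{u} B) : ℕ∞ :=
  sSup {c : ℕ∞ | ∃ n : ℕ, c = n ∧ domdimGE B Q X n}

/-- Relative codominant dimension with respect to `Q`, as an element of `ℕ∞`. -/
def relCodomDim (Q X : ModuleCat.{u} B) : ℕ∞ :=
  sSup {c : ℕ∞ | ∃ n : ℕ, c = n ∧ codomdimGE B Q X n}

/-- A projective resolution. -/
structure ProjRes (X : ModuleCat.{u} B) where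
  P : ℕ → ModuleCat.{u} B
  d : ∀ j, P (j+1) →ₗ[B] P j
  aug : P 0 →ₗ[B] X
  proj : ∀ j, Module.Projective B (P j)
  augSurj : Function.Surjective aug
  exact0 : Function.Exact (d 0) aug
  exact : ∀ j, Function.Exact (d (j+1)) (d j)

/-- Vanishing of `Ext^i(X, Y)`, expressed via projective resolutions. -/
def ExtVanish (X Y : ModuleCat.{u} B) : ℕ → Prop
  | 0 => Subsingleton (X →ₗ[B] Y)
  | (i+1) => ∀ R : ProjRes B X, ∀ f : R.P (i+1) →ₗ[B] Y,
      f ∘ₗ R.d (i+1) = 0 → ∃ g : R.P i →ₗ[B] Y, f = g ∘ₗ R.d i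

/-- `Q` is self-orthogonal: `Ext^i(Q, Q) = 0` for all `i > 0`. -/
def SelfOrth (Q : ModuleCat.{u} B) : Prop := ∀ i, 1 ≤ i → ExtVanish B Q Q i

/-- `Z` is a (first, minimal) syzygy of `X`. -/
def IsSyzygyOf (X Z : ModuleCat.{u} B) : Prop :=
  ∃ (P : ModuleCat.{u} B) (p : P →ₗ[B] X), IsProjCover B p ∧
    Nonempty (Z ≃ₗ[B] LinearMap.ker p)

/-- `Z` is an `n`-th syzygy `Ω^n X`. -/
def IsOmegaOf : ℕ → ModuleCat.{u} B → ModuleCat.{u} B → Prop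
  | 0, X, Z => Nonempty (Z ≃ₗ[B] X)
  | (n+1), X, Z => ∃ Y, IsSyzygyOf B X Y ∧ IsOmegaOf n Y Z

/-- `Z` is a (first, minimal) cosyzygy of `X`. -/
def IsCosyzygyOf (X Z : ModuleCat.{u} B) : Prop :=
  ∃ (I : ModuleCat.{u} B) (ι : X →ₗ[B] I), IsInjEnvelope B ι ∧
    Nonempty (Z ≃ₗ[B] (I ⧸ LinearMap.range ι))

/-- `Z` is an `n`-th cosyzygy `Ω^{-n} X`. -/
def IsOmegaInvOf : ℕ → ModuleCat.{u} B → ModuleCat.{u} B → Prop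
  | 0, X, Z => Nonempty (Z ≃ₗ[B] X)
  | (n+1), X, Z => ∃ Y, IsCosyzygyOf B X Y ∧ IsOmegaInvOf n Y Z

/-- Precomposition with `g`, as a map of right `B`-modules `Hom(P₀,B) → Hom(P₁,B)`. -/
def lprecomp {P1 P0 : ModuleCat.{u} B} (g : P1 →ₗ[B] P0) :
    (P0 →ₗ[B] B) →ₗ[Bᵐᵒᵖ] (P1 →ₗ[B] B) where
  toFun h := h ∘ₗ g
  map_add' _ _ := rfl
  map_smul' _ _ := rfl

/-- `T` is a transpose `Tr X` (computed from a minimal projective presentation). -/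
def IsTransposeOf (X : ModuleCat.{u} B) (T : ModuleCat.{u} Bᵐᵒᵖ) : Prop :=
  ∃ (P1 P0 : ModuleCat.{u} B) (g : P1 →ₗ[B] P0) (p : P0 →ₗ[B] X),
    IsProjCover B p ∧ Module.Projective B P1 ∧ Function.Exact g p ∧
    Superfluous B (LinearMap.ker g) ∧
    Nonempty (T ≃ₗ[Bᵐᵒᵖ] ((P1 →ₗ[B] B) ⧸ LinearMap.range (lprecomp B g)))

/-- The canonical ring homomorphism `B →+* Bᵐᵒᵖᵐᵒᵖ`. -/
def opOpHom : B →+* Bᵐᵒᵖᵐᵒᵖ where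
  toFun b := op (op b)
  map_one' := rfl
  map_mul' _ _ := rfl
  map_zero' := rfl
  map_add' _ _ := rfl


/-- An `F_Mo`-projective resolution: terms in `add(B ⊕ Mo)`, exact, and remaining
exact under `Hom(Mo, −)`. -/
structure FProjRes (Mo X : ModuleCat.{u} B) where
  P : ℕ → ModuleCat.{u} B
  d : ∀ j, P (j+1) →ₗ[B] P j
  aug : P 0 →ₗ[B] X
  mem : ∀ j, InAdd B (ModuleCat.of B (B × Mo)) (P j)
  augSurj : Function.Surjective aug
  exact0 : Function.Exact (d 0) aug
  exact : ∀ j, Function.Exact (d (j+1)) (d j)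
  lift0 : ∀ f : Mo →ₗ[B] X, ∃ h : Mo →ₗ[B] P 0, aug ∘ₗ h = f
  lift1 : ∀ f : Mo →ₗ[B] P 0, aug ∘ₗ f = 0 → ∃ h : Mo →ₗ[B] P 1, d 0 ∘ₗ h = f
  lift : ∀ j, ∀ f : Mo →ₗ[B] P (j+1), d j ∘ₗ f = 0 →
    ∃ h : Mo →ₗ[B] P (j+2), d (j+1) ∘ₗ h = f

/-- Vanishing of the relative extension group `Ext^i_{F_Mo}(X, Y)`, computed via
`F_Mo`-projective resolutions. -/
def FExtVanish (Mo X Y : ModuleCat.{u} B) : ℕ → Prop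
  | 0 => True
  | (i+1) => ∀ R : FProjRes B Mo X, ∀ f : R.P (i+1) →ₗ[B] Y,
      f ∘ₗ R.d (i+1) = 0 → ∃ g : R.P i →ₗ[B] Y, f = g ∘ₗ R.d i

end RingDefs

section Duality
variable (k : Type u) [Field k] (B : Type u) [Ring B] [Algebra k B]

noncomputable instance kmod (X : ModuleCat.{u} B) : Module k X :=
  Module.compHom X (algebraMap k B)

instance kmodSMulComm (X : ModuleCat.{u} B) : SMulCommClass B k X :=
  ⟨fun b c x => by
    show b • ((algebraMap k B c) • x) = (algebraMap k B c) • (b • x)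
    rw [← mul_smul, ← mul_smul, Algebra.commutes]⟩

instance kmodTower (X : ModuleCat.{u} B) : IsScalarTower k B X :=
  ⟨fun c b x => by
    show (c • b) • x = (algebraMap k B c) • (b • x)
    rw [Algebra.smul_def, mul_smul]⟩

noncomputable instance dualModL (X : ModuleCat.{u} B) : Module Bᵐᵒᵖ (X →ₗ[k] k) where
  smul b φ := φ ∘ₗ (DistribMulAction.toLinearMap k X b.unop)
  one_smul φ := by
    ext x
    show φ ((1 : Bᵐᵒᵖ).unop • x) = φ x
    rw [unop_one, one_smul]
  mul_smul b c φ := by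
    ext x
    show φ ((b * c).unop • x) = φ (c.unop • b.unop • x)
    rw [unop_mul, mul_smul]
  smul_zero b := rfl
  smul_add b φ ψ := rfl
  add_smul b c φ := by
    ext x
    show φ ((b + c).unop • x) = φ (b.unop • x) + φ (c.unop • x)
    rw [unop_add, add_smul, map_add]
  zero_smul φ := by
    ext x
    show φ ((0 : Bᵐᵒᵖ).unop • x) = 0
    rw [unop_zero, zero_smul, map_zero]

/-- The standard duality `D = Hom_k(−, k)`, sending a left `B`-module to a right
`B`-module. -/
def Dop (X : ModuleCat.{u} B) : ModuleCat.{u} Bᵐᵒᵖ :=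
  ModuleCat.of Bᵐᵒᵖ (X →ₗ[k] k)

noncomputable instance dualModR (Y : ModuleCat.{u} Bᵐᵒᵖ) : Module B (Y →ₗ[k] k) where
  smul b φ := φ ∘ₗ (DistribMulAction.toLinearMap k Y (op b))
  one_smul φ := by
    ext x
    show φ ((op (1:B)) • x) = φ x
    rw [op_one, one_smul]
  mul_smul b c φ := by
    ext x
    show φ ((op (b * c)) • x) = φ ((op c) • (op b) • x)
    rw [op_mul, mul_smul]
  smul_zero b := rfl
  smul_add b φ ψ := rfl
  add_smul b c φ := by
    ext x
    show φ ((op (b + c)) • x) = φ ((op b) • x) + φ ((op c) • x)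
    rw [op_add, add_smul, map_add]
  zero_smul φ := by
    ext x
    show φ ((op (0 : B)) • x) = 0
    rw [op_zero, zero_smul, map_zero]

/-- The standard duality `D = Hom_k(−, k)`, sending a right `B`-module to a left
`B`-module. -/
def Dunop (Y : ModuleCat.{u} Bᵐᵒᵖ) : ModuleCat.{u} B :=
  ModuleCat.of B (Y →ₗ[k] k)

/-- `D(B_B)`, the standard injective cogenerator of `B`-Mod. -/
def Dcogen : ModuleCat.{u} B := Dunop k B (ModuleCat.of Bᵐᵒᵖ B)

/-- `T ≅ τ X = D Tr X`, the Auslander–Reiten translate. -/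
def IsTauOf (X T : ModuleCat.{u} B) : Prop :=
  ∃ Tr : ModuleCat.{u} Bᵐᵒᵖ, IsTransposeOf B X Tr ∧ Nonempty (T ≃ₗ[B] Dunop k B Tr)

/-- `T ≅ τ_n X = τ Ω^{n-1} X`. -/
def IsTauN (n : ℕ) (X T : ModuleCat.{u} B) : Prop :=
  ∃ Z, IsOmegaOf B (n-1) X Z ∧ IsTauOf k B Z T

/-- `T ≅ τ⁻ X = Tr D X`, the inverse Auslander–Reiten translate. -/
def IsTauInvOf (X T : ModuleCat.{u} B) : Prop :=
  ∃ Tr2 : ModuleCat.{u} Bᵐᵒᵖᵐᵒᵖ, IsTransposeOf Bᵐᵒᵖ (Dop k B X) Tr2 ∧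
    Nonempty (T ≃ₗ[B] ((ModuleCat.restrictScalars (opOpHom B)).obj Tr2))

/-- `T ≅ τ⁻_n X = τ⁻ Ω^{-(n-1)} X`. -/
def IsTauInvN (n : ℕ) (X T : ModuleCat.{u} B) : Prop :=
  ∃ Z, IsOmegaInvOf B (n-1) X Z ∧ IsTauInvOf k B Z T

/-- The Nakayama functor `ν = D Hom_B(−, B)` (on objects). -/
def nu (X : ModuleCat.{u} B) : ModuleCat.{u} B :=
  Dunop k B (ModuleCat.of Bᵐᵒᵖ (X →ₗ[B] B))

/-- The inverse Nakayama functor `ν⁻ = Hom_B(D(−), B)` (on objects). -/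
def nuInv (X : ModuleCat.{u} B) : ModuleCat.{u} B :=
  (ModuleCat.restrictScalars (opOpHom B)).obj
    (ModuleCat.of Bᵐᵒᵖᵐᵒᵖ ((Dop k B X) →ₗ[Bᵐᵒᵖ] Bᵐᵒᵖ))

/-- Relative `add Q`-dimension of `X` is at most `m`. -/
def RelAddDimLE (Q X : ModuleCat.{u} B) (m : ℕ) : Prop :=
  ResLE B Q (InAdd B Q) X m

/-- Relative `add Q`-codimension of `X` is at most `m`. -/
def RelAddCodimLE (Q X : ModuleCat.{u} B) (m : ℕ) : Prop :=
  CoresLE B Q (InAdd B Q) X m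

/-- `Q` is an `l`-quasi-generator (without minimality of `l`). -/
def QuasiGenLE (Q : ModuleCat.{u} B) (l : ℕ) : Prop :=
  CoresLE B Q (InAdd B Q) (ModuleCat.of B B) l

/-- `Q` is an `l`-quasi-generator: `l` is minimal. -/
def IsQuasiGen (Q : ModuleCat.{u} B) (l : ℕ) : Prop :=
  QuasiGenLE B Q l ∧ ∀ j, QuasiGenLE B Q j → l ≤ j

/-- `Q` is an `m`-quasi-cogenerator (without minimality of `m`). -/
def QuasiCogenLE (Q : ModuleCat.{u} B) (m : ℕ) : Prop :=
  ResLE B Q (InAdd B Q) (Dcogen k B) m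

/-- `Q` is an `m`-quasi-cogenerator: `m` is minimal. -/
def IsQuasiCogen (Q : ModuleCat.{u} B) (m : ℕ) : Prop :=
  QuasiCogenLE k B Q m ∧ ∀ j, QuasiCogenLE k B Q j → m ≤ j

/-- `(B, Q)` is a relative `n`-Auslander–Gorenstein pair. -/
def IsRelAGPair (Q : ModuleCat.{u} B) (n : ℕ) : Prop :=
  idLE B (ModuleCat.of B B) n ∧ idLE Bᵐᵒᵖ (ModuleCat.of Bᵐᵒᵖ Bᵐᵒᵖ) n ∧
  SelfOrth B Q ∧ domdimGE B Q (ModuleCat.of B B) n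

/-- `Q` is an `(n, m, l)`-quasi-precluster tilting module. -/
def IsQPCT (Q : ModuleCat.{u} B) (n m l : ℕ) : Prop :=
  (∀ i, 1 ≤ i → i ≤ n - 2 → ExtVanish B Q Q i) ∧
  IsQuasiGen B Q l ∧
  IsQuasiCogen k B Q m ∧
  (∃ T, IsTauN k B (n - m - 1) Q T ∧ RelAddDimLE B Q T m) ∧
  (∃ T, IsTauInvN k B (n - l - 1) Q T ∧ RelAddCodimLE B Q T l)

/-- Precomposition with `g`, as a `k`-linear map between Hom spaces. -/
def pcompk {X Y Z : ModuleCat.{u} B} (g : X →ₗ[B] Y) :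
    (Y →ₗ[B] Z) →ₗ[k] (X →ₗ[B] Z) where
  toFun h := h ∘ₗ g
  map_add' _ _ := rfl
  map_smul' _ _ := rfl


/-- `I` is an injective object for the exact structure `F_Mo`: it lies in
`add(DB ⊕ τ Mo)`. -/
def IsFInj (Mo I : ModuleCat.{u} B) : Prop :=
  ∃ T, IsTauOf k B Mo T ∧ InAdd B (ModuleCat.of B ((Dcogen k B) × T)) I

/-- `T` is an `F_Mo`-cotilting object: finite relative injective dimension, no relative
self-extensions, and the relative injectives `DB ⊕ τ Mo` admit a finite `F_Mo`-exact
resolution by objects of `add T`. -/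
def FCotilting (Mo T : ModuleCat.{u} B) : Prop :=
  (∃ r, CoresLE B Mo (IsFInj k B Mo) T r) ∧
  (∀ i, 1 ≤ i → FExtVanish B Mo T T i) ∧
  (∃ τM, IsTauOf k B Mo τM ∧
    ∃ r, ResLE B Mo (InAdd B T) (ModuleCat.of B ((Dcogen k B) × τM)) r)

end Duality

section EndStuff
variable (A : Type u) [Ring A] (Q : ModuleCat.{u} A)

/-- The canonical ring homomorphism `A → End_{End_A(Q)}(Q)`. -/
def toEndE : A →+* Module.End (Module.End A Q) Q where
  toFun a :=
    { toFun := fun q => a • q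
      map_add' := fun x y => smul_add a x y
      map_smul' := fun e q => (e.map_smul a q).symm }
  map_one' := by ext q; exact one_smul A q
  map_mul' x y := by ext q; exact mul_smul x y q
  map_zero' := by ext q; exact zero_smul A q
  map_add' x y := by ext q; exact add_smul x y q

/-- `Hom_A(Q, X)` as a left module over `End_A(Q)ᵐᵒᵖ` (i.e. a left `Λ`-module) by
precomposition. -/
noncomputable instance homPrecompMod (X : ModuleCat.{u} A) :
    Module (Module.End A Q)ᵐᵒᵖ (Q →ₗ[A] X) where
  smul e f := f ∘ₗ e.unop
  one_smul f := by ext q; rfl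
  mul_smul e e' f := by ext q; rfl
  smul_zero e := rfl
  smul_add e f g := rfl
  add_smul e e' f := by ext q; exact map_add f _ _
  zero_smul f := by ext q; exact map_zero f

/-- The actions of `A` and of `End_A(Q)` on `Q` commute. -/
instance endSMulComm : SMulCommClass (Module.End A Q) A Q :=
  ⟨fun e a q => e.map_smul a q⟩

instance endSMulComm' : SMulCommClass A (Module.End A Q) Q :=
  ⟨fun a e q => (e.map_smul a q).symm⟩

end EndStuff

end Paper
end

noncomputable section Helpers1
open Paper CategoryTheory CategoryTheory.Abelian
namespace PaperAux

section
variable {B : Type} [Ring B]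

/-- Vanishing of Mathlib's Ext. -/
def EV (X Y : ModuleCat.{0} B) (i : ℕ) : Prop := ∀ e : Ext.{0} X Y i, e = 0

/-- short exact sequence of modules. -/
structure SES {X Y Z : ModuleCat.{0} B} (f : X →ₗ[B] Y) (g : Y →ₗ[B] Z) : Prop where
  inj : Function.Injective f
  ex : Function.Exact f g
  surj : Function.Surjective g

variable {X Y Z W : ModuleCat.{0} B} {f : X →ₗ[B] Y} {g : Y →ₗ[B] Z}

/-- the associated short complex. -/
abbrev SES.sc (h : SES f g) : ShortComplex (ModuleCat.{0} B) :=
  ShortComplex.mk (ModuleCat.ofHom f) (ModuleCat.ofHom g) (by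
    ext x; exact h.ex.apply_apply_eq_zero x)

lemma SES.se (h : SES f g) : h.sc.ShortExact where
  exact := by
    rw [ShortComplex.moduleCat_exact_iff]
    intro x hx
    exact (h.ex x).1 hx
  mono_f := (ModuleCat.mono_iff_injective _).2 h.inj
  epi_g := (ModuleCat.epi_iff_surjective _).2 h.surj

lemma EV.cov3 (h : SES f g) {i : ℕ} (h2 : EV W Y i) (h1 : EV W X (i+1)) : EV W Z i := by
  intro e
  obtain ⟨x, hx⟩ := Ext.covariant_sequence_exact₃ W h.se (n₀ := i) e rfl (h1 _)
  have h0 : x = 0 := h2 x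
  rw [← hx, h0, Ext.zero_comp]

lemma EV.cov1 (h : SES f g) {i : ℕ} (h3 : EV W Z i) (h2 : EV W Y (i+1)) : EV W X (i+1) := by
  intro e
  obtain ⟨x, hx⟩ := Ext.covariant_sequence_exact₁ W h.se (n₁ := i+1) e (h2 _) rfl
  have h0 : x = 0 := h3 x
  rw [← hx, h0, Ext.zero_comp]

lemma EV.con3 (h : SES f g) {i : ℕ} (h1 : EV X W i) (h2 : EV Y W (i+1)) : EV Z W (i+1) := by
  intro e
  obtain ⟨x, hx⟩ := Ext.contravariant_sequence_exact₃ h.se W (n₁ := i+1) e (h2 _) (n₀ := i)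
    (by omega)
  have h0 : x = 0 := h1 x
  rw [← hx, h0, Ext.comp_zero]

lemma EV.con1 (h : SES f g) {i : ℕ} (h3 : EV Z W (i+1)) (h2 : EV Y W i) : EV X W i := by
  intro e
  obtain ⟨x, hx⟩ := Ext.contravariant_sequence_exact₁ h.se W (n₀ := i) e (n₁ := i+1) (by omega)
    (h3 _)
  have h0 : x = 0 := h2 x
  rw [← hx, h0, Ext.comp_zero]

lemma EV.lift (h : SES f g) (h1 : EV W X 1) (u : W →ₗ[B] Z) : ∃ v : W →ₗ[B] Y, g ∘ₗ v = u := by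
  obtain ⟨x, hx⟩ := Ext.covariant_sequence_exact₃ W h.se (n₀ := 0) (Ext.mk₀ (ModuleCat.ofHom u))
    rfl (h1 _)
  obtain ⟨v, rfl⟩ := (Ext.mk₀_bijective _ _).2 x
  rw [Ext.mk₀_comp_mk₀] at hx
  have := (Ext.mk₀_bijective _ _).1 hx
  exact ⟨v.hom, congrArg ModuleCat.Hom.hom this⟩

lemma EV.extend (h : SES f g) (h1 : EV Z W 1) (u : X →ₗ[B] W) : ∃ v : Y →ₗ[B] W, v ∘ₗ f = u := by
  obtain ⟨x, hx⟩ := Ext.contravariant_sequence_exact₁ h.se W (n₀ := 0)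
    (Ext.mk₀ (ModuleCat.ofHom u)) (n₁ := 1) rfl (h1 _)
  obtain ⟨v, rfl⟩ := (Ext.mk₀_bijective _ _).2 x
  rw [Ext.mk₀_comp_mk₀] at hx
  have := (Ext.mk₀_bijective _ _).1 hx
  exact ⟨v.hom, congrArg ModuleCat.Hom.hom this⟩

lemma EV.of_proj (hX : Module.Projective B X) (i : ℕ) : EV X Y (i+1) := by
  intro e
  have : Projective X := (IsProjective.iff_projective X).1 hX
  exact Ext.eq_zero_of_projective e

lemma EV.of_inj (hX : Module.Injective B X) (i : ℕ) : EV Y X (i+1) := by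
  intro e
  have : Injective X := (Module.injective_iff_injective_object B X).1 hX
  exact Ext.eq_zero_of_injective e

lemma EV.of_extend (h : SES f g) (hP : Module.Projective B Y)
    (hext : ∀ u : X →ₗ[B] W, ∃ v : Y →ₗ[B] W, v ∘ₗ f = u) : EV Z W 1 := by
  intro e
  obtain ⟨x, hx⟩ := Ext.contravariant_sequence_exact₃ h.se W (n₁ := 1) e (EV.of_proj hP 0 _)
    (n₀ := 0) rfl
  obtain ⟨u, rfl⟩ := (Ext.mk₀_bijective _ _).2 x
  obtain ⟨v, hv⟩ : ∃ v : h.sc.X₂ ⟶ W, u = h.sc.f ≫ v := by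
    obtain ⟨v, hv⟩ := hext u.hom
    exact ⟨ModuleCat.ofHom v, by ext x; exact (LinearMap.congr_fun hv x).symm⟩
  rw [← hx, hv, ← Ext.mk₀_comp_mk₀]
  exact h.se.extClass_comp_assoc _

lemma EV.inj_of (h : ∀ Y : ModuleCat.{0} B, EV Y X 1) : Module.Injective B X := by
  rw [Module.injective_iff_injective_object, injective_iff_subsingleton_ext_one.{0}]
  intro Y
  exact ⟨fun a b => by rw [h Y a, h Y b]⟩

/-- finite-retract data: `X` is a summand of a finite power of `Y`. -/
def Ret (Y X : ModuleCat.{0} B) : Prop :=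
  ∃ (n : ℕ) (s : Fin n → (X →ₗ[B] Y)) (r : Fin n → (Y →ₗ[B] X)), ∀ x, ∑ i, r i (s i x) = x

lemma ret_iff : InAdd B Y X ↔ Ret Y X := by
  constructor
  · rintro ⟨n, s, r, h⟩
    refine ⟨n, fun i => LinearMap.proj i ∘ₗ s, fun i => r ∘ₗ LinearMap.single B (fun _ => Y) i, fun x => ?_⟩
    have := LinearMap.congr_fun h x
    simp only [LinearMap.comp_apply, LinearMap.proj_apply, LinearMap.id_apply] at this ⊢
    rw [← map_sum]
    convert this
    ext j
    simp [Finset.sum_apply, Pi.single_apply]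
  · rintro ⟨n, s, r, h⟩
    refine ⟨n, LinearMap.pi s, ∑ i, r i ∘ₗ LinearMap.proj i, ?_⟩
    ext x
    simpa using h x

lemma Ret.ev (hr : Ret Y X) {i : ℕ} (h : EV W Y i) : EV W X i := by
  obtain ⟨n, s, r, hsr⟩ := hr
  intro e
  have : 𝟙 X = ∑ j, ModuleCat.ofHom (s j) ≫ ModuleCat.ofHom (r j) := by
    ext x
    simpa [ModuleCat.hom_sum] using (hsr x).symm
  rw [← Ext.comp_mk₀_id e, this, Ext.mk₀_sum, Ext.comp_sum]
  refine Finset.sum_eq_zero fun j _ => ?_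
  rw [← Ext.mk₀_comp_mk₀, ← Ext.comp_assoc_of_second_deg_zero, h (e.comp _ _), Ext.zero_comp]

/-- SES from kernel. -/
lemma SES.ker (g : Y →ₗ[B] Z) (hg : Function.Surjective g) :
    SES (X := ModuleCat.of B (LinearMap.ker g)) (LinearMap.ker g).subtype g :=
  ⟨Subtype.val_injective, LinearMap.exact_subtype_ker_map g, hg⟩

lemma SES.coker (f : X →ₗ[B] Y) (hf : Function.Injective f) :
    SES (Z := ModuleCat.of B (Y ⧸ LinearMap.range f)) f (LinearMap.range f).mkQ :=
  ⟨hf, LinearMap.exact_map_mkQ_range f, Submodule.mkQ_surjective _⟩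

end

end PaperAux
end Helpers1

noncomputable section Helpers2
open Paper CategoryTheory CategoryTheory.Abelian
namespace PaperAux

section
variable {B : Type} [Ring B]

lemma Ret.of_equiv {X Y : ModuleCat.{0} B} (e : X ≃ₗ[B] Y) : Ret Y X :=
  ⟨1, fun _ => e.toLinearMap, fun _ => e.symm.toLinearMap, fun x => by simp⟩

lemma ev_of_cores (Y : ModuleCat.{0} B) (n : ℕ) : ∀ (X : ModuleCat.{0} B)
    (M : ℕ → ModuleCat.{0} B) (ι : X →ₗ[B] M 0) (d : ∀ j, M j →ₗ[B] M (j+1))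
    (_ : ∀ j, j ≤ n → Module.Injective B (M j)) (_ : ∀ j, n < j → Subsingleton (M j))
    (_ : Function.Injective ι) (_ : Function.Exact ι (d 0))
    (_ : ∀ j, Function.Exact (d j) (d (j+1))) (i : ℕ), n ≤ i → EV Y X (i+1) := by
  induction n with
  | zero =>
    intro X M ι d h1 h2 h3 h4 h5 i hi
    have hs : Function.Surjective ι := fun y => (h4 y).1 (by
      have := h2 1 one_pos
      exact Subsingleton.elim _ _)
    exact (Ret.of_equiv (LinearEquiv.ofBijective ι ⟨h3, hs⟩)).ev (EV.of_inj (h1 0 le_rfl) i)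
  | succ n ih =>
    intro X M ι d h1 h2 h3 h4 h5 i hi
    obtain ⟨i, rfl⟩ : ∃ i', i = i' + 1 := ⟨i - 1, by omega⟩
    have hS := SES.coker ι h3
    have hk : LinearMap.range ι = LinearMap.ker (d 0) := by
      ext x; exact (h4 x).symm
    refine EV.cov1 hS (ih (ModuleCat.of B (M 0 ⧸ LinearMap.range ι)) (fun j => M (j+1))
      ((LinearMap.range ι).liftQ (d 0) hk.le) (fun j => d (j+1)) ?_ ?_ ?_ ?_ ?_ i (by omega))
      (EV.of_inj (h1 0 (by omega)) _)
    · intro j hj; exact h1 _ (by omega)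
    · intro j hj; exact h2 _ (by omega)
    · rw [← LinearMap.ker_eq_bot]
      exact Submodule.ker_liftQ_eq_bot _ _ _ hk.ge
    · intro x
      rw [h5 0 x]
      constructor
      · rintro ⟨y, rfl⟩; exact ⟨Submodule.Quotient.mk y, rfl⟩
      · rintro ⟨y, rfl⟩
        obtain ⟨y, rfl⟩ := Submodule.Quotient.mk_surjective _ y
        exact ⟨y, rfl⟩
    · intro j; exact h5 _

lemma ev_of_idLE {X Y : ModuleCat.{0} B} {n : ℕ} (h : idLE B X n) {i : ℕ} (hi : n ≤ i) :
    EV Y X (i+1) := by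
  obtain ⟨M, ι, d, h1, h2, h3, h4, h5, -⟩ := h
  exact ev_of_cores Y n X M ι d h1 h2 h3 h4 h5 i hi

lemma ev_of_res (Y : ModuleCat.{0} B) (i : ℕ) : ∀ (X : ModuleCat.{0} B)
    (P : ℕ → ModuleCat.{0} B) (d : ∀ j, P (j+1) →ₗ[B] P j) (aug : P 0 →ₗ[B] X)
    (_ : ∀ j, j ≤ i → Module.Projective B (P j)) (_ : Function.Surjective aug)
    (_ : Function.Exact (d 0) aug) (_ : ∀ j, j < i → Function.Exact (d (j+1)) (d j))
    (_ : ∀ f : P (i+1) →ₗ[B] Y, (∀ x, d i x = 0 → f x = 0) → ∃ g : P i →ₗ[B] Y, g ∘ₗ d i = f),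
    EV X Y (i+1) := by
  induction i with
  | zero =>
    intro X P d aug h1 h2 h3 h4 h5
    refine EV.of_extend (SES.ker aug h2) (h1 0 le_rfl) fun u => ?_
    have hk : ∀ x, d 0 x ∈ LinearMap.ker aug := fun x => h3.apply_apply_eq_zero x
    obtain ⟨g, hg⟩ := h5 (u ∘ₗ (d 0).codRestrict _ hk) (fun x hx => by
      have : (d 0).codRestrict _ hk x = 0 := Subtype.ext hx
      rw [LinearMap.comp_apply, this, map_zero])
    refine ⟨g, ?_⟩
    ext ⟨x, hx⟩
    obtain ⟨y, rfl⟩ := (h3 x).1 hx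
    exact LinearMap.congr_fun hg y
  | succ i ih =>
    intro X P d aug h1 h2 h3 h4 h5
    have hk : ∀ x, d 0 x ∈ LinearMap.ker aug := fun x => h3.apply_apply_eq_zero x
    refine EV.con3 (SES.ker aug h2) (ih _ (fun j => P (j+1)) (fun j => d (j+1))
      ((d 0).codRestrict _ hk) ?_ ?_ ?_ ?_ ?_) (EV.of_proj (h1 0 (by omega)) _)
    · intro j hj; exact h1 _ (by omega)
    · rintro ⟨x, hx⟩
      obtain ⟨y, rfl⟩ := (h3 x).1 hx
      exact ⟨y, rfl⟩
    · intro x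
      rw [← h4 0 (by omega) x]
      exact Subtype.ext_iff
    · intro j hj; exact h4 _ (by omega)
    · exact h5

lemma projRes_of_pdLE {X : ModuleCat.{0} B} {n : ℕ} (h : pdLE B X n) :
    ∃ R : ProjRes B X, ∀ j, n < j → Subsingleton (R.P j) := by
  obtain ⟨P, d, aug, h1, h2, h3, h4, h5, -⟩ := h
  refine ⟨⟨P, d, aug, fun j => ?_, h3, h4, h5⟩, h2⟩
  by_cases hj : j ≤ n
  · exact h1 j hj
  · have := h2 j (by omega)
    exact ⟨0, fun x => Subsingleton.elim _ _⟩

lemma ev_of_pdLE {X Y : ModuleCat.{0} B} {n : ℕ} (h : pdLE B X n) {i : ℕ} (hi : n ≤ i) :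
    EV X Y (i+1) := by
  obtain ⟨R, hR⟩ := projRes_of_pdLE h
  refine ev_of_res Y i X R.P R.d R.aug (fun j _ => R.proj j) R.augSurj R.exact0
    (fun j _ => R.exact j) fun f _ => ⟨0, ?_⟩
  have := hR (i+1) (by omega)
  ext x
  rw [Subsingleton.elim x 0, map_zero, map_zero]

lemma ev_of_extVanish {X Y : ModuleCat.{0} B} (R : ProjRes B X) {i : ℕ}
    (h : ExtVanish B X Y (i+1)) : EV X Y (i+1) := by
  refine ev_of_res Y i X R.P R.d R.aug (fun j _ => R.proj j) R.augSurj R.exact0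
    (fun j _ => R.exact j) fun f hf => ?_
  obtain ⟨g, hg⟩ := h R f (by ext x; exact hf _ ((R.exact i).apply_apply_eq_zero x))
  exact ⟨g, hg.symm⟩

lemma Ret.refl (X : ModuleCat.{0} B) : Ret X X := Ret.of_equiv (LinearEquiv.refl B X)

/-- base of the resolution -/
lemma resLE_zero {test : ModuleCat.{0} B} {T : ModuleCat.{0} B → Prop} {X : ModuleCat.{0} B}
    (hX : T X) : ResLE B test T X 0 := by
  refine ⟨fun j => Nat.casesOn j X (fun _ => zeroMod B), fun j => 0, LinearMap.id, ?_, ?_,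
    Function.surjective_id, ?_, ?_, ?_, ?_, ?_⟩
  · intro j hj
    obtain rfl : j = 0 := by omega
    exact hX
  · intro j hj
    obtain ⟨j, rfl⟩ : ∃ i', j = i' + 1 := ⟨j - 1, by omega⟩
    exact (inferInstance : Subsingleton PUnit)
  · intro x
    constructor
    · rintro rfl; exact ⟨0, by simp⟩
    · rintro ⟨y, rfl⟩; simp
  · intro j x
    have : x = 0 := (inferInstance : Subsingleton PUnit).elim _ _
    subst this
    simp only [map_zero, Set.mem_range, true_iff]
    exact ⟨0, map_zero _⟩
  · intro f; exact ⟨f, rfl⟩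
  · intro f hf
    exact ⟨0, by rw [LinearMap.comp_zero]; exact hf.symm⟩
  · intro j f hf
    refine ⟨0, ?_⟩
    ext x
    exact (inferInstance : Subsingleton PUnit).elim _ _

/-- inductive step of the resolution -/
lemma resLE_succ {test : ModuleCat.{0} B} {T : ModuleCat.{0} B → Prop} {X Y P : ModuleCat.{0} B}
    {f : Y →ₗ[B] P} {g : P →ₗ[B] X} (h : SES f g) (hP : T P)
    (hl : ∀ u : test →ₗ[B] X, ∃ v : test →ₗ[B] P, g ∘ₗ v = u) {m : ℕ}
    (hY : ResLE B test T Y m) : ResLE B test T X (m+1) := by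
  obtain ⟨M, d, aug, h1, h2, h3, h4, h5, h6, h7, h8⟩ := hY
  refine ⟨fun j => Nat.casesOn j P M,
    fun j => Nat.rec (motive := fun j => (Nat.casesOn (j+1) P M : ModuleCat.{0} B) →ₗ[B]
      (Nat.casesOn j P M : ModuleCat.{0} B)) (f ∘ₗ aug) (fun j _ => d j) j, g, ?_, ?_,
    h.surj, ?_, ?_, hl, ?_, ?_⟩
  · intro j hj
    cases j with
    | zero => exact hP
    | succ j => exact h1 j (by omega)
  · intro j hj
    cases j with
    | zero => omega
    | succ j => exact h2 j (by omega)
  · intro x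
    rw [h.ex x]
    constructor
    · rintro ⟨y, rfl⟩
      obtain ⟨z, rfl⟩ := h3 y
      exact ⟨z, rfl⟩
    · rintro ⟨y, rfl⟩; exact ⟨aug y, rfl⟩
  · intro j
    cases j with
    | zero =>
      intro x
      rw [← h4 x]
      change f (aug x) = 0 ↔ _
      rw [← map_zero f, h.inj.eq_iff]
    | succ j => exact h5 j
  · intro u hu
    have hk : ∀ x, ∃ y, f y = u x := fun x => (h.ex _).1 (LinearMap.congr_fun hu x)
    let e := LinearEquiv.ofInjective f h.inj
    let w : test →ₗ[B] Y := e.symm.toLinearMap ∘ₗ u.codRestrict (LinearMap.range f) hk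
    have hw : f ∘ₗ w = u := by
      ext x
      have := congrArg Subtype.val (e.apply_symm_apply (u.codRestrict (LinearMap.range f) hk x))
      exact this
    obtain ⟨v, hv⟩ := h6 w
    refine ⟨v, ?_⟩
    change (f ∘ₗ aug) ∘ₗ v = u
    rw [LinearMap.comp_assoc, hv, hw]
  · intro j
    cases j with
    | zero =>
      intro u hu
      refine h7 u ?_
      ext x
      exact h.inj (by rw [LinearMap.zero_apply, map_zero]; exact LinearMap.congr_fun hu x)
    | succ j => exact h8 j

lemma resLE_equiv {test : ModuleCat.{0} B} {T : ModuleCat.{0} B → Prop} {X Y : ModuleCat.{0} B}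
    (e : Y ≃ₗ[B] X) {m : ℕ} (hY : ResLE B test T Y m) : ResLE B test T X m := by
  obtain ⟨M, d, aug, h1, h2, h3, h4, h5, h6, h7, h8⟩ := hY
  refine ⟨M, d, e.toLinearMap ∘ₗ aug, h1, h2, e.surjective.comp h3, ?_, h5, ?_, ?_, h8⟩
  · intro x
    rw [← h4 x]
    simp
  · intro u
    obtain ⟨v, hv⟩ := h6 (e.symm.toLinearMap ∘ₗ u)
    refine ⟨v, ?_⟩
    rw [LinearMap.comp_assoc, hv]
    ext x; simp
  · intro u hu
    refine h7 u ?_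
    ext x
    apply e.injective
    rw [LinearMap.zero_apply, map_zero]
    exact LinearMap.congr_fun hu x

/-- projective covers of finite modules are finite -/
lemma finite_of_superfluous {P X : ModuleCat.{0} B} (p : P →ₗ[B] X)
    (hf : (LinearMap.range p).FG) (hs : Superfluous B (LinearMap.ker p)) : Module.Finite B P := by
  obtain ⟨s, hs'⟩ := hf
  have : ∀ x : X, x ∈ s → ∃ y : P, p y = x := fun x hx => by
    have : x ∈ LinearMap.range p := hs' ▸ Submodule.subset_span hx
    exact this
  choose! c hc using this
  classical
  refine ⟨⟨s.image c, hs _ ?_⟩⟩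
  rw [eq_top_iff]
  intro y _
  have hmap : Submodule.map p (Submodule.span B (s.image c : Set P)) = LinearMap.range p := by
    rw [Submodule.map_span, ← hs', Finset.coe_image, ← Set.image_comp]
    congr 1
    ext x
    constructor
    · rintro ⟨z, hz, rfl⟩; rw [Function.comp, hc z hz]; exact hz
    · intro hx; exact ⟨x, hx, hc x hx⟩
  obtain ⟨z, hz, hzy⟩ : p y ∈ Submodule.map p (Submodule.span B (s.image c : Set P)) := by
    rw [hmap]; exact ⟨y, rfl⟩
  rw [show y = z + (y - z) by abel]
  exact Submodule.add_mem_sup hz (by rw [LinearMap.mem_ker, map_sub, hzy, sub_self])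

/-- f.g. projectives are summands of free modules of finite rank -/
lemma ret_of_proj {P : ModuleCat.{0} B} (hp : Module.Projective B P) (hf : Module.Finite B P) :
    Ret (ModuleCat.of B B) P := by
  obtain ⟨n, f, hf⟩ := Module.Finite.exists_fin' B P
  obtain ⟨s, hs⟩ := Module.projective_lifting_property f LinearMap.id hf
  exact ret_iff.1 ⟨n, s, f, hs⟩

lemma Ret.projective {P : ModuleCat.{0} B} (h : Ret (ModuleCat.of B B) P) :
    Module.Projective B P := by
  obtain ⟨n, s, r, h⟩ := ret_iff.2 h
  have : Module.Projective B (Fin n → (ModuleCat.of B B)) :=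
    inferInstanceAs (Module.Projective B (Fin n → B))
  exact Module.Projective.of_split s r h

lemma Ret.finite {X Y : ModuleCat.{0} B} (h : Ret Y X) [Module.Finite B Y] :
    Module.Finite B X := by
  obtain ⟨n, s, r, h⟩ := ret_iff.2 h
  exact Module.Finite.of_surjective r (fun x => ⟨s x, LinearMap.congr_fun h x⟩)

end

end PaperAux
end Helpers2

noncomputable section Helpers3
open Paper CategoryTheory CategoryTheory.Abelian
namespace PaperAux

section
variable {B C : Type} [Ring B] [Ring C] (Q : Type) [AddCommGroup Q] [Module B Q] [Module C Q]
  [SMulCommClass B C Q]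

variable (B C) in
/-- `Hom_B(X, Q)` as a `C`-module. -/
def star (X : ModuleCat.{0} B) : ModuleCat.{0} C := ModuleCat.of C (X →ₗ[B] Q)

variable (C) in
/-- functoriality of `star`. -/
def sMap {X Y : ModuleCat.{0} B} (g : X →ₗ[B] Y) : star B C Q Y →ₗ[C] star B C Q X where
  toFun h := (show Y →ₗ[B] Q from h) ∘ₗ g
  map_add' _ _ := rfl
  map_smul' _ _ := rfl

lemma star_ret {X Y : ModuleCat.{0} B} (h : Ret Y X) : Ret (star B C Q Y) (star B C Q X) := by
  obtain ⟨n, s, r, h⟩ := h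
  refine ⟨n, fun i => sMap C Q (r i), fun i => sMap C Q (s i), fun x => ?_⟩
  refine LinearMap.ext (fun y => ?_ : ∀ y, _ = (show X →ₗ[B] Q from x) y)
  have : ∀ y, (∑ i, (show X →ₗ[B] Q from x) ((r i) ((s i) y))) = (show X →ₗ[B] Q from x) y := by
    intro y; rw [← map_sum, h]
  rw [← this y]
  exact LinearMap.sum_apply (Finset.univ)
    (fun i => (((show X →ₗ[B] Q from x) ∘ₗ (r i)) ∘ₗ (s i) : X →ₗ[B] Q)) y

lemma Ret.trans_equiv {X Y Y' : ModuleCat.{0} B} (h : Ret Y X) (e : Y ≃ₗ[B] Y') : Ret Y' X := by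
  obtain ⟨n, s, r, h⟩ := h
  exact ⟨n, fun i => e.toLinearMap ∘ₗ s i, fun i => r i ∘ₗ e.symm.toLinearMap,
    fun x => by simpa using h x⟩

lemma star_ses {X Y Z : ModuleCat.{0} B} {f : X →ₗ[B] Y} {g : Y →ₗ[B] Z} (h : SES f g)
    (he : EV Z (ModuleCat.of B Q) 1) : SES (sMap C Q g) (sMap C Q f) where
  inj := fun u v huv => LinearMap.ext fun z => by
    obtain ⟨y, rfl⟩ := h.surj z
    exact LinearMap.congr_fun huv y
  ex := fun u => by
    constructor
    · intro hu
      have hk : LinearMap.ker g ≤ LinearMap.ker (show Y →ₗ[B] Q from u) := by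
        intro y hy
        obtain ⟨x, rfl⟩ := (h.ex y).1 hy
        exact LinearMap.congr_fun (f := (show Y →ₗ[B] Q from u) ∘ₗ f) (g := 0) hu x
      let e := g.quotKerEquivOfSurjective h.surj
      refine ⟨(LinearMap.ker g).liftQ (show Y →ₗ[B] Q from u) hk ∘ₗ e.symm.toLinearMap,
        LinearMap.ext fun y => ?_⟩
      change (LinearMap.ker g).liftQ (show Y →ₗ[B] Q from u) hk (e.symm (g y)) = _
      have : e.symm (g y) = Submodule.Quotient.mk y := by
        rw [LinearEquiv.symm_apply_eq]; rfl
      rw [this]; rfl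
    · rintro ⟨v, rfl⟩
      refine LinearMap.ext fun x => ?_
      change (show Z →ₗ[B] Q from v) (g (f x)) = 0
      rw [h.ex.apply_apply_eq_zero, map_zero]
  surj := fun u => EV.extend h he (show X →ₗ[B] Q from u)

variable (B C) in
/-- `Hom_B(B,Q) = Q`. -/
def starFree : star B C Q (ModuleCat.of B B) ≃ₗ[C] (ModuleCat.of C Q) where
  toFun h := (show B →ₗ[B] Q from h) 1
  invFun q := (LinearMap.toSpanSingleton B Q q : B →ₗ[B] Q)
  map_add' _ _ := rfl
  map_smul' _ _ := rfl
  left_inv h := LinearMap.ext_ring (by simp [LinearMap.toSpanSingleton_apply])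
  right_inv q := by simp [LinearMap.toSpanSingleton_apply]

end

section
variable {A : Type} [Ring A] (Q : ModuleCat.{0} A)

/-- `Q` as a module over its endomorphism ring. -/
abbrev QE : ModuleCat.{0} (Module.End A Q) := ModuleCat.of (Module.End A Q) Q

/-- `Hom_A(Q,Q) = E`. -/
def starQ : star A (Module.End A Q) Q Q ≃ₗ[Module.End A Q]
    (ModuleCat.of (Module.End A Q) (Module.End A Q)) where
  toFun h := h
  invFun h := h
  map_add' _ _ := rfl
  map_smul' _ _ := rfl
  left_inv _ := rfl
  right_inv _ := rfl

variable {Q}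

lemma proj_star {M : ModuleCat.{0} A} (h : Ret Q M) :
    Module.Projective (Module.End A Q) (star A (Module.End A Q) Q M) :=
  ((star_ret (C := Module.End A Q) Q h).trans_equiv (starQ Q)).projective

lemma ev_inj {M : ModuleCat.{0} A} (h : Ret Q M) {m : M}
    (hm : ∀ h : M →ₗ[A] Q, h m = 0) : m = 0 := by
  obtain ⟨n, s, r, h⟩ := h
  rw [← h m]
  exact Finset.sum_eq_zero fun i _ => by rw [hm, map_zero]

lemma ev_surj {M : ModuleCat.{0} A} (h : Ret Q M)
    (φ : star A (Module.End A Q) Q M →ₗ[Module.End A Q] Q) :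
    ∃ m : M, ∀ h : M →ₗ[A] Q, φ h = h m := by
  obtain ⟨n, s, r, h⟩ := h
  refine ⟨∑ i, r i (φ (s i)), fun u => ?_⟩
  rw [map_sum]
  have h1 : ∀ i, u (r i (φ (s i))) =
      φ ((show Module.End A Q from u ∘ₗ r i) • (show star A (Module.End A Q) Q M from s i)) := by
    intro i; rw [map_smul]; rfl
  simp_rw [h1]
  rw [← map_sum]
  congr 1
  refine LinearMap.ext (fun y => ?_ : ∀ y, u y = _)
  have h2 : u y = ∑ i, u (r i (s i y)) := by rw [← map_sum, h]
  rw [h2]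
  exact (LinearMap.sum_apply (Finset.univ) (fun i => ((u ∘ₗ r i) ∘ₗ (s i) : M →ₗ[A] Q)) y).symm

/-- Consequences of relative dominant dimension. -/
lemma domdim_consequences {n : ℕ} (hn : 2 ≤ n) (h : domdimGE A Q (ModuleCat.of A A) n) :
    (∀ φ : Q →ₗ[Module.End A Q] Q, ∃ a : A, ∀ q, φ q = a • q) ∧
    (∀ a : A, (∀ q : Q, a • q = 0) → a = 0) ∧
    (∀ i, i + 3 ≤ n → EV (QE Q) (QE Q) (i+1)) := by
  rcases h with rfl | ⟨M, ι, d, h1, h2, h3, h4, h5, h6, h7⟩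
  · omega
  have h1' : ∀ j, j + 1 ≤ n → Ret Q (M j) := fun j hj => ret_iff.1 (h1 j hj)
  have h3 := h3 hn
  have h6 := h6 hn
  let aug : star A (Module.End A Q) Q (M 0) →ₗ[Module.End A Q] QE Q :=
    (starFree A (Module.End A Q) Q).toLinearMap ∘ₗ sMap (Module.End A Q) Q ι
  have haug : ∀ u : M 0 →ₗ[A] Q, aug u = u (ι (1 : A)) := fun u => rfl
  have hι : ∀ a : A, ι a = a • ι (1 : A) := fun a => by
    rw [← map_smul]; congr 1; exact (mul_one a).symm
  have hsurj : ∀ q : Q, ∃ u : M 0 →ₗ[A] Q, ∀ a : A, u (ι a) = a • q := by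
    intro q
    obtain ⟨u, hu⟩ := h5 (LinearMap.toSpanSingleton A Q q)
    exact ⟨u, fun a => LinearMap.congr_fun hu a⟩
  refine ⟨?_, ?_, ?_⟩
  · intro φ
    obtain ⟨m, hm⟩ := ev_surj (h1' 0 (by omega)) (φ ∘ₗ aug)
    have hm0 : d 0 m = 0 := by
      refine ev_inj (h1' 1 (by omega)) fun u => ?_
      have h8 : φ (u (d 0 (ι (1 : A)))) = u (d 0 m) := hm (u ∘ₗ d 0)
      rw [← h8, h3.apply_apply_eq_zero, map_zero, map_zero]
    obtain ⟨a, rfl⟩ := (h3 m).1 hm0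
    refine ⟨a, fun q => ?_⟩
    obtain ⟨u, hu⟩ := hsurj q
    have : φ (u (ι (1 : A))) = u (ι a) := hm u
    rw [hu, hu, one_smul] at this
    exact this
  · intro a ha
    have : ι a = 0 := ev_inj (h1' 0 (by omega)) fun u => by
      rw [hι, map_smul, ha]
    exact h2 (by rw [this, map_zero])
  · intro i hi
    refine ev_of_res (QE Q) i (QE Q) (fun j => star A (Module.End A Q) Q (M j))
      (fun j => sMap (Module.End A Q) Q (d j)) aug ?_ ?_ ?_ ?_ ?_
    · intro j hj; exact proj_star (h1' j (by omega))
    · intro q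
      obtain ⟨u, hu⟩ := hsurj q
      exact ⟨u, by rw [haug, hu, one_smul]⟩
    · intro u
      constructor
      · intro hu
        obtain ⟨v, hv⟩ := h6 u (LinearMap.ext_ring hu)
        exact ⟨v, hv⟩
      · rintro ⟨v, rfl⟩
        change (show M 1 →ₗ[A] Q from v) (d 0 (ι (1:A))) = 0
        rw [h3.apply_apply_eq_zero, map_zero]
    · intro j hj u
      constructor
      · intro hu; exact h7 j (by omega) u hu
      · rintro ⟨v, rfl⟩
        refine LinearMap.ext fun x => ?_
        change (show M (j+2) →ₗ[A] Q from v) (d (j+1) (d j x)) = 0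
        rw [(h4 j (by omega)).apply_apply_eq_zero, map_zero]
    · intro f hf
      obtain ⟨m, hm⟩ := ev_surj (h1' (i+1) (by omega)) f
      have hm0 : d (i+1) m = 0 := by
        refine ev_inj (h1' (i+2) (by omega)) fun u => ?_
        have := hm (u ∘ₗ d (i+1))
        rw [← LinearMap.comp_apply, ← this]
        apply hf
        refine LinearMap.ext fun x => ?_
        change u (d (i+1) (d i x)) = 0
        rw [(h4 i (by omega)).apply_apply_eq_zero, map_zero]
      obtain ⟨m', rfl⟩ := (h4 i (by omega) m).1 hm0
      refine ⟨{ toFun := fun u => (show M i →ₗ[A] Q from u) m'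
                map_add' := fun _ _ => rfl
                map_smul' := fun _ _ => rfl }, ?_⟩
      ext u
      exact (hm u).symm

end

end PaperAux
end Helpers3

noncomputable section Helpers4
open Paper CategoryTheory CategoryTheory.Abelian
namespace PaperAux

section
variable {A : Type} [Ring A] {Q : ModuleCat.{0} A}

lemma EV.congr1 {B : Type} [Ring B] {X X' Y : ModuleCat.{0} B} (e : X' ≃ₗ[B] X) {i : ℕ}
    (h : EV X Y i) : EV X' Y i := by
  intro x
  have h1 : ModuleCat.ofHom e.toLinearMap ≫ ModuleCat.ofHom e.symm.toLinearMap = 𝟙 X' := by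
    ext y; simp
  rw [← Ext.mk₀_id_comp x, ← h1, ← Ext.mk₀_comp_mk₀_assoc, h (Ext.comp _ x _), Ext.comp_zero]

variable (Q) in
/-- The functor `Hom_E(-, Q)`. -/
abbrev S (X : ModuleCat.{0} (Module.End A Q)) : ModuleCat.{0} A := star (Module.End A Q) A Q X

lemma ret_S {P : ModuleCat.{0} (Module.End A Q)} (hp : Module.Projective (Module.End A Q) P)
    (hf : Module.Finite (Module.End A Q) P) : Ret Q (S Q P) :=
  (star_ret (C := A) Q (ret_of_proj hp hf)).trans_equiv (starFree (Module.End A Q) A Q)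

/-- The inductive invariant for syzygies. -/
structure Good (Q : ModuleCat.{0} A) (c e t : ℕ) (X : ModuleCat.{0} (Module.End A Q)) : Prop where
  fin : Module.Finite (Module.End A Q) X
  extE : ∀ i, i + 1 ≤ c → EV X (QE Q) (i+1)
  extA : ∀ i, e ≤ i → EV Q (S Q X) (i+1)
  idA : ∀ i, t ≤ i → ∀ Y, EV Y (S Q X) (i+1)

/-- star on an equiv -/
def starEquiv {X Y : ModuleCat.{0} (Module.End A Q)} (e : X ≃ₗ[Module.End A Q] Y) :
    S Q X ≃ₗ[A] S Q Y :=
  LinearEquiv.ofLinear (sMap A Q e.symm.toLinearMap) (sMap A Q e.toLinearMap)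
    (LinearMap.ext fun x => LinearMap.ext fun y => by
      change (show Y →ₗ[Module.End A Q] Q from x) (e (e.symm y)) = _
      rw [e.apply_symm_apply]; rfl)
    (LinearMap.ext fun x => LinearMap.ext fun y => by
      change (show X →ₗ[Module.End A Q] Q from x) (e.symm (e y)) = _
      rw [e.symm_apply_apply]; rfl)

lemma Good.equiv {c e t : ℕ} {X Y : ModuleCat.{0} (Module.End A Q)} (h : Good Q c e t X)
    (φ : Y ≃ₗ[Module.End A Q] X) : Good Q c e t Y where
  fin := by
    have := h.fin
    exact Module.Finite.equiv φ.symm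
  extE i hi := (h.extE i hi).congr1 φ
  extA i hi := (Ret.of_equiv (starEquiv φ)).ev (h.extA i hi)
  idA i hi W := (Ret.of_equiv (starEquiv φ)).ev (h.idA i hi W)

lemma Good.syzygy {m : ℕ} (hQ : ∀ i, EV Q Q (i+1)) (hid : ∀ i, m ≤ i → ∀ Y, EV Y Q (i+1))
    [IsNoetherianRing (Module.End A Q)]
    {c e t : ℕ} {X Y : ModuleCat.{0} (Module.End A Q)} (h : Good Q (c+1) e t X)
    (ht : m + 1 ≤ t) (hY : IsSyzygyOf (Module.End A Q) X Y) : Good Q c (e-1) (t-1) Y := by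
  obtain ⟨P, p, ⟨hp, hs, hsup⟩, ⟨φ⟩⟩ := hY
  have := h.fin
  have hfin : Module.Finite (Module.End A Q) P := finite_of_superfluous p
    (by rw [LinearMap.range_eq_top.2 hs]; exact Module.Finite.fg_top) hsup
  have hr := ret_S hp hfin
  refine Good.equiv (X := ModuleCat.of (Module.End A Q) (LinearMap.ker p)) ?_ φ
  have hS := SES.ker p hs
  have hS' := star_ses (C := A) Q hS (h.extE 0 (by omega))
  refine ⟨?_, ?_, ?_, ?_⟩
  · exact (inferInstance : Module.Finite (Module.End A Q) (LinearMap.ker p))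
  · intro i hi
    exact EV.con1 hS (h.extE (i+1) (by omega)) (EV.of_proj hp i)
  · intro i hi
    exact EV.cov3 hS' (hr.ev (hQ i)) (h.extA (i+1) (by omega))
  · intro i hi W
    exact EV.cov3 hS' (hr.ev (hid i (by omega) W)) (h.idA (i+1) (by omega) W)

lemma Good.omega {m : ℕ} (hQ : ∀ i, EV Q Q (i+1)) (hid : ∀ i, m ≤ i → ∀ Y, EV Y Q (i+1))
    [IsNoetherianRing (Module.End A Q)]
    (r : ℕ) : ∀ {c e t : ℕ} {X Z : ModuleCat.{0} (Module.End A Q)},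
    Good Q (c+r) e t X → m + r ≤ t → IsOmegaOf (Module.End A Q) r X Z →
    Good Q c (e-r) (t-r) Z := by
  induction r with
  | zero =>
    rintro c e t X Z h ht ⟨φ⟩
    exact h.equiv φ
  | succ r ih =>
    rintro c e t X Z h ht ⟨Y, hY, hZ⟩
    have h1 : Good Q (c+r) (e-1) (t-1) Y := Good.syzygy hQ hid (c := c + r) h (by omega) hY
    have h2 := ih h1 (by omega) hZ
    rwa [show e - 1 - r = e - (r+1) by omega, show t - 1 - r = t - (r+1) by omega] at h2

/-- The module `K` and its properties. -/
lemma exists_K {m : ℕ} (hQ : ∀ i, EV Q Q (i+1)) (hid : ∀ i, m ≤ i → ∀ Y, EV Y Q (i+1))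
    [IsNoetherianRing (Module.End A Q)]
    {t : ℕ} {Z P1 P0 : ModuleCat.{0} (Module.End A Q)} [Module.Finite A Q]
    (h : Good Q 0 0 t Z) (ht : t ≤ m + 2)
    {g : P1 →ₗ[Module.End A Q] P0} {p : P0 →ₗ[Module.End A Q] Z}
    (hp : IsProjCover (Module.End A Q) p) (hP1 : Module.Projective (Module.End A Q) P1)
    (hex : Function.Exact g p) (hsup : Superfluous (Module.End A Q) (LinearMap.ker g)) :
    ∃ (K : ModuleCat.{0} A) (π : S Q P1 →ₗ[A] K), Module.Finite A K ∧
      (∀ i, EV Q K (i+1)) ∧ (∀ i, m ≤ i → ∀ Y, EV Y K (i+1)) ∧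
      (∀ u : Q →ₗ[A] K, ∃ v : Q →ₗ[A] S Q P1, π ∘ₗ v = u) ∧
      (∀ v : Q →ₗ[A] S Q P1, π ∘ₗ v = 0 ↔ ∃ w : Q →ₗ[A] S Q P0, sMap A Q g ∘ₗ w = v) := by
  obtain ⟨hP0, hs, hsup0⟩ := hp
  have := h.fin
  have hfin0 : Module.Finite (Module.End A Q) P0 := finite_of_superfluous p
    (by rw [LinearMap.range_eq_top.2 hs]; exact Module.Finite.fg_top) hsup0
  have hfin1 : Module.Finite (Module.End A Q) P1 := finite_of_superfluous g
    (IsNoetherian.noetherian _) hsup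
  have hr0 := ret_S hP0 hfin0
  have hr1 := ret_S hP1 hfin1
  let G := sMap A Q g
  let I : ModuleCat.{0} A := ModuleCat.of A (LinearMap.range G)
  have hk : LinearMap.range g = LinearMap.ker p := by
    ext x; exact (hex x).symm
  have hS1 : SES (Z := I) (sMap A Q p) G.rangeRestrict := by
    refine ⟨?_, ?_, LinearMap.surjective_rangeRestrict G⟩
    · intro u v huv
      refine LinearMap.ext fun z => ?_
      obtain ⟨y, rfl⟩ := hs z
      exact LinearMap.congr_fun huv y
    · intro u
      have hz : G.rangeRestrict u = 0 ↔ G u = 0 := Subtype.ext_iff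
      rw [hz]
      constructor
      · intro hu
        let u' : P0 →ₗ[Module.End A Q] Q := u
        have hk' : LinearMap.ker p ≤ LinearMap.ker u' := by
          rw [← hk]
          rintro _ ⟨x, rfl⟩
          exact LinearMap.congr_fun (f := u' ∘ₗ g) (g := 0) hu x
        let e := p.quotKerEquivOfSurjective hs
        refine ⟨(LinearMap.ker p).liftQ u' hk' ∘ₗ e.symm.toLinearMap,
          LinearMap.ext fun y => ?_⟩
        change (LinearMap.ker p).liftQ u' hk' (e.symm (p y)) = _
        have : e.symm (p y) = Submodule.Quotient.mk y := by
          rw [LinearEquiv.symm_apply_eq]; rfl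
        rw [this]; rfl
      · rintro ⟨v, rfl⟩
        refine LinearMap.ext fun x => ?_
        change (show Z →ₗ[Module.End A Q] Q from v) (p (g x)) = 0
        rw [hex.apply_apply_eq_zero, map_zero]
  have hS2 : SES (X := I) (Z := ModuleCat.of A (S Q P1 ⧸ LinearMap.range G))
      (LinearMap.range G).subtype (LinearMap.range G).mkQ :=
    ⟨Subtype.val_injective, LinearMap.exact_subtype_mkQ _, Submodule.mkQ_surjective _⟩
  have hI1 : ∀ i, EV Q I (i+1) := fun i => EV.cov3 hS1 (hr0.ev (hQ i)) (h.extA (i+1) (by omega))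
  have hI2 : ∀ i, m + 1 ≤ i → ∀ Y, EV Y I (i+1) := fun i hi Y =>
    EV.cov3 hS1 (hr0.ev (hid i (by omega) Y)) (h.idA (i+1) (by omega) Y)
  refine ⟨ModuleCat.of A (S Q P1 ⧸ LinearMap.range G), (LinearMap.range G).mkQ, ?_, ?_, ?_, ?_, ?_⟩
  · have : Module.Finite A (S Q P1) := hr1.finite
    exact (inferInstance : Module.Finite A (S Q P1 ⧸ LinearMap.range G))
  · exact fun i => EV.cov3 hS2 (hr1.ev (hQ i)) (hI1 _)
  · exact fun i hi Y => EV.cov3 hS2 (hr1.ev (hid i hi Y)) (hI2 _ (by omega) Y)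
  · exact fun u => EV.lift hS2 (hI1 0) u
  · intro v
    constructor
    · intro hv
      have hmem : ∀ q, v q ∈ LinearMap.range G := fun q => by
        have := LinearMap.congr_fun hv q
        exact (Submodule.Quotient.mk_eq_zero _).1 this
      obtain ⟨w, hw⟩ := EV.lift hS1 (h.extA 0 le_rfl) (v.codRestrict _ hmem)
      exact ⟨w, LinearMap.ext fun q => congrArg Subtype.val (LinearMap.congr_fun hw q)⟩
    · rintro ⟨w, rfl⟩
      refine LinearMap.ext fun q => ?_
      exact (Submodule.Quotient.mk_eq_zero _).2 ⟨w q, rfl⟩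

end

end PaperAux
end Helpers4

noncomputable section Helpers5
open Paper CategoryTheory CategoryTheory.Abelian
namespace PaperAux

section
variable (k : Type) [Field k] {B : Type} [Ring B] [Algebra k B]

/-- functoriality of the duality. -/
def DMap {Y Y' : ModuleCat.{0} Bᵐᵒᵖ} (f : Y →ₗ[Bᵐᵒᵖ] Y') : Dunop k B Y' →ₗ[B] Dunop k B Y where
  toFun φ := (show Y' →ₗ[k] k from φ) ∘ₗ f.restrictScalars k
  map_add' _ _ := rfl
  map_smul' b φ := by
    refine LinearMap.ext (fun y => ?_ : ∀ y : Y, _)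
    exact congrArg (show Y' →ₗ[k] k from φ) (f.map_smul (MulOpposite.op b) y).symm

lemma DMap_ses {X Y Z : ModuleCat.{0} Bᵐᵒᵖ} {f : X →ₗ[Bᵐᵒᵖ] Y} {g : Y →ₗ[Bᵐᵒᵖ] Z} (h : SES f g) :
    SES (DMap k g) (DMap k f) where
  inj := fun u v huv => LinearMap.ext fun z => by
    obtain ⟨y, rfl⟩ := h.surj z
    exact LinearMap.congr_fun huv y
  ex := fun u => by
    constructor
    · intro hu
      obtain ⟨s, hs⟩ := LinearMap.exists_rightInverse_of_surjective (g.restrictScalars k)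
        (LinearMap.range_eq_top.2 h.surj)
      refine ⟨(show Y →ₗ[k] k from u) ∘ₗ s, LinearMap.ext fun y => ?_⟩
      change (show Y →ₗ[k] k from u) (s (g y)) = (show Y →ₗ[k] k from u) y
      have h1 : g (s (g y)) = g y := LinearMap.congr_fun hs (g y)
      have h2 : g (s (g y) - y) = 0 := by rw [map_sub, h1, sub_self]
      obtain ⟨x, hx⟩ := (h.ex _).1 h2
      have h3 : (show Y →ₗ[k] k from u) (f x) = 0 := LinearMap.congr_fun hu x
      rw [hx, map_sub] at h3
      exact sub_eq_zero.1 h3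
    · rintro ⟨v, rfl⟩
      refine LinearMap.ext fun x => ?_
      change (show Z →ₗ[k] k from v) (g (f x)) = 0
      rw [h.ex.apply_apply_eq_zero, map_zero]
  surj := fun u => by
    obtain ⟨s, hs⟩ := LinearMap.exists_leftInverse_of_injective (f.restrictScalars k)
      (LinearMap.ker_eq_bot.2 h.inj)
    refine ⟨(show X →ₗ[k] k from u) ∘ₗ s, LinearMap.ext fun x => ?_⟩
    change (show X →ₗ[k] k from u) (s (f x)) = (show X →ₗ[k] k from u) x
    exact congrArg _ (LinearMap.congr_fun hs x)

/-- the duality on isomorphisms. -/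
def DEquiv {Y Y' : ModuleCat.{0} Bᵐᵒᵖ} (e : Y ≃ₗ[Bᵐᵒᵖ] Y') : Dunop k B Y' ≃ₗ[B] Dunop k B Y where
  __ := DMap k e.toLinearMap
  invFun := DMap k e.symm.toLinearMap
  left_inv φ := LinearMap.ext fun y => congrArg (show Y' →ₗ[k] k from φ) (e.apply_symm_apply y)
  right_inv φ := LinearMap.ext fun y => congrArg (show Y →ₗ[k] k from φ) (e.symm_apply_apply y)

end

section
variable (k : Type) [Field k] {A : Type} [Ring A] [Algebra k A] (Q : ModuleCat.{0} A)

/-- `Hom_A(Q,X)`. -/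
def H (X : ModuleCat.{0} A) : ModuleCat.{0} (Module.End A Q)ᵐᵒᵖ :=
  ModuleCat.of (Module.End A Q)ᵐᵒᵖ (Q →ₗ[A] X)

/-- functoriality. -/
def HMap {X Y : ModuleCat.{0} A} (f : X →ₗ[A] Y) : H Q X →ₗ[(Module.End A Q)ᵐᵒᵖ] H Q Y where
  toFun u := f ∘ₗ (show Q →ₗ[A] X from u)
  map_add' _ _ := LinearMap.ext fun _ => map_add f _ _
  map_smul' _ _ := rfl

lemma HMap_ses {X Y Z : ModuleCat.{0} A} {f : X →ₗ[A] Y} {g : Y →ₗ[A] Z} (h : SES f g)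
    (hX : EV Q X 1) : SES (HMap Q f) (HMap Q g) where
  inj := fun u v huv => LinearMap.ext fun q => h.inj (LinearMap.congr_fun huv q)
  ex := fun u => by
    constructor
    · intro hu
      have hq : ∀ q, ∃ x, f x = (show Q →ₗ[A] Y from u) q := fun q =>
        (h.ex _).1 (LinearMap.congr_fun hu q)
      let e := LinearEquiv.ofInjective f h.inj
      have hm : ∀ q, (show Q →ₗ[A] Y from u) q ∈ LinearMap.range f := hq
      refine ⟨e.symm.toLinearMap ∘ₗ LinearMap.codRestrict _ (show Q →ₗ[A] Y from u) hm,
        LinearMap.ext fun q => ?_⟩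
      exact congrArg Subtype.val (e.apply_symm_apply ⟨_, hm q⟩)
    · rintro ⟨v, rfl⟩
      exact LinearMap.ext fun q => h.ex.apply_apply_eq_zero _
  surj := fun u => EV.lift h hX (show Q →ₗ[A] Z from u)

/-- `D Hom_A(Q,X)`. -/
def G (X : ModuleCat.{0} A) : ModuleCat.{0} (Module.End A Q) := Dunop k (Module.End A Q) (H Q X)

/-- functoriality. -/
def GMap {X Y : ModuleCat.{0} A} (f : X →ₗ[A] Y) : G k Q Y →ₗ[Module.End A Q] G k Q X :=
  DMap k (HMap Q f)

lemma GMap_ses {X Y Z : ModuleCat.{0} A} {f : X →ₗ[A] Y} {g : Y →ₗ[A] Z} (h : SES f g)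
    (hX : EV Q X 1) : SES (GMap k Q g) (GMap k Q f) := DMap_ses k (HMap_ses Q h hX)

lemma G_ret {X Y : ModuleCat.{0} A} (h : Ret Y X) : Ret (G k Q Y) (G k Q X) := by
  obtain ⟨n, s, r, h⟩ := h
  refine ⟨n, fun i => GMap k Q (r i), fun i => GMap k Q (s i), fun φ => ?_⟩
  refine LinearMap.ext (fun u => ?_ : ∀ u : H Q X, _)
  let φ' : H Q X →ₗ[k] k := φ
  let u' : Q →ₗ[A] X := u
  have h1 : (∑ i, (show H Q X from r i ∘ₗ (s i ∘ₗ u'))) = u := by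
    refine LinearMap.ext (fun q => ?_ : ∀ q, _ = u' q)
    rw [← h (u' q)]
    exact LinearMap.sum_apply Finset.univ (fun i => (r i ∘ₗ (s i ∘ₗ u') : Q →ₗ[A] X)) q
  change _ = φ' u
  conv_rhs => rw [← h1, map_sum]
  exact LinearMap.sum_apply Finset.univ
    (fun i => (φ' ∘ₗ (HMap Q (r i)).restrictScalars k ∘ₗ (HMap Q (s i)).restrictScalars k :
      H Q X →ₗ[k] k)) u

end
end PaperAux
end Helpers5

noncomputable section Helpers6
open Paper CategoryTheory CategoryTheory.Abelian
namespace PaperAux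

section
variable (k : Type) [Field k] {A : Type} [Ring A] [Algebra k A]

lemma kmod_smul (X : ModuleCat.{0} A) (c : k) (x : X) : c • x = algebraMap k A c • x := rfl

variable (A) in
/-- the regular right module. -/
def AR : ModuleCat.{0} Aᵐᵒᵖ := ModuleCat.of Aᵐᵒᵖ A

variable (A) in
/-- the injective cogenerator. -/
abbrev J : ModuleCat.{0} A := Dunop k A (AR A)

/-- evaluation of an element of `J`. -/
def jev (φ : J k A) (a : A) : k := (show AR A →ₗ[k] k from φ) a

variable {k} in
lemma jext {φ ψ : J k A} (h : ∀ a, jev k φ a = jev k ψ a) : φ = ψ := LinearMap.ext h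

lemma jev_add (φ ψ : J k A) (a : A) : jev k (φ + ψ) a = jev k φ a + jev k ψ a := rfl

lemma jev_smul (b : A) (φ : J k A) (a : A) : jev k (b • φ) a = jev k φ (a * b) := rfl

lemma jev_ksmul (φ : J k A) (c : k) (a : A) : jev k φ (c • a) = c * jev k φ a := by
  have h := (show AR A →ₗ[k] k from φ).map_smul c a
  have h2 : (c • (show AR A from a)) = (c • a : A) := by
    change a * algebraMap k A c = c • a
    rw [Algebra.smul_def, Algebra.commutes]
  rw [h2] at h
  exact h

lemma jev_ksmul' (φ : J k A) (c : k) (a : A) : jev k (c • φ) a = c * jev k φ a := by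
  rw [kmod_smul, jev_smul, ← jev_ksmul, Algebra.smul_def, Algebra.commutes]

/-- cofreeness of `J`. -/
def cofree {X : ModuleCat.{0} A} (μ : X →ₗ[k] k) : X →ₗ[A] J k A where
  toFun x :=
    ({ toFun := fun a => μ ((show A from a) • x)
       map_add' := fun a b => by rw [← map_add, ← add_smul]; rfl
       map_smul' := fun c a => by
        change μ (((show A from a) * algebraMap k A c) • x) = c • μ ((show A from a) • x)
        rw [← map_smul, kmod_smul, ← mul_smul, Algebra.commutes] } : AR A →ₗ[k] k)
  map_add' x y := jext fun a => by
    change μ (a • (x + y)) = μ (a • x) + μ (a • y)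
    rw [smul_add, map_add]
  map_smul' b x := jext fun a => by
    change μ (a • b • x) = μ ((a * b) • x)
    rw [mul_smul]

lemma jev_cofree {X : ModuleCat.{0} A} (μ : X →ₗ[k] k) (x : X) (a : A) :
    jev k (cofree k μ x) a = μ (a • x) := rfl

/-- the functional attached to a map into `J`. -/
def jfun {X : ModuleCat.{0} A} (F : X →ₗ[A] J k A) : X →ₗ[k] k where
  toFun x := jev k (F x) 1
  map_add' x y := by rw [map_add, jev_add]
  map_smul' c x := by
    rw [kmod_smul, map_smul, ← kmod_smul, jev_ksmul']; rfl

lemma cofree_jfun {X : ModuleCat.{0} A} (F : X →ₗ[A] J k A) : cofree k (jfun k F) = F := by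
  refine LinearMap.ext fun x => jext fun a => ?_
  rw [jev_cofree]
  change jev k (F (a • x)) 1 = _
  rw [map_smul, jev_smul, one_mul]

lemma J_inj_aux {X Y : ModuleCat.{0} A} (f : X →ₗ[A] Y) (hf : Function.Injective f)
    (g : X →ₗ[A] J k A) : ∃ h : Y →ₗ[A] J k A, ∀ x, h (f x) = g x := by
  obtain ⟨s, hs⟩ := LinearMap.exists_leftInverse_of_injective (f.restrictScalars k)
      (LinearMap.ker_eq_bot.2 hf)
  refine ⟨cofree k (jfun k g ∘ₗ s), fun x => ?_⟩
  have h : ∀ x, s (f x) = x := fun x => LinearMap.congr_fun hs x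
  refine jext fun a => ?_
  have h1 : jev k (cofree k (jfun k g ∘ₗ s) (f x)) a = jfun k g (s (a • f x)) := rfl
  rw [h1, ← map_smul, h]
  change jev k (g (a • x)) 1 = jev k (g x) a
  rw [map_smul, jev_smul, one_mul]

variable (A) in
lemma J_inj : Module.Injective A (J k A) :=
  ⟨fun {X Y} _ _ _ _ f hf g => J_inj_aux k (X := ModuleCat.of A X) (Y := ModuleCat.of A Y) f hf g⟩

variable (A) in
/-- a power of `J`. -/
def JP (N : ℕ) : ModuleCat.{0} A := ModuleCat.of A (Fin N → J k A)

variable (A) in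
lemma JP_inj (N : ℕ) : Module.Injective A (JP k A N) := by
  refine ⟨fun {X Y} _ _ _ _ f hf g => ?_⟩
  choose h hh using fun i : Fin N =>
    (J_inj k A).out f hf ((LinearMap.proj i : (Fin N → J k A) →ₗ[A] J k A) ∘ₗ g)
  exact ⟨LinearMap.pi h, fun x => funext fun i => hh i x⟩

variable (A) in
lemma JP_ret (N : ℕ) : Ret (J k A) (JP k A N) :=
  ⟨N, fun i => (LinearMap.proj i : (Fin N → J k A) →ₗ[A] J k A),
    fun i => LinearMap.single A (fun _ => J k A) i, fun x => LinearMap.sum_single_apply _ x⟩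

variable (A) in
lemma JP_fin [FiniteDimensional k A] (N : ℕ) : Module.Finite k (JP k A N) := by
  let b := Module.finBasis k A
  let F : JP k A N →ₗ[k] (Fin N → Fin (Module.finrank k A) → k) :=
    { toFun := fun φ i j => jev k ((show Fin N → J k A from φ) i) (b j)
      map_add' := fun φ ψ => rfl
      map_smul' := fun c φ => funext fun i => funext fun j =>
        jev_ksmul' k ((show Fin N → J k A from φ) i) c (b j) }
  refine Module.Finite.of_injective F fun φ ψ h => ?_
  refine funext fun i => ?_
  let φ' : A →ₗ[k] k :=
    { toFun := jev k ((show Fin N → J k A from φ) i)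
      map_add' := fun a b => (show AR A →ₗ[k] k from
        (show Fin N → J k A from φ) i).map_add a b
      map_smul' := fun c a => jev_ksmul k _ c a }
  let ψ' : A →ₗ[k] k :=
    { toFun := jev k ((show Fin N → J k A from ψ) i)
      map_add' := fun a b => (show AR A →ₗ[k] k from
        (show Fin N → J k A from ψ) i).map_add a b
      map_smul' := fun c a => jev_ksmul k _ c a }
  have h1 : φ' = ψ' := b.ext fun j => congrFun (congrFun h i) j
  exact jext fun a => LinearMap.congr_fun h1 a

lemma finite_of_surj {X Y : ModuleCat.{0} A} [Module.Finite k X] (f : X →ₗ[A] Y)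
    (hf : Function.Surjective f) : Module.Finite k Y :=
  Module.Finite.of_surjective (f.restrictScalars k) hf

lemma exists_embed (X : ModuleCat.{0} A) [Module.Finite k X] :
    ∃ (N : ℕ) (f : X →ₗ[A] JP k A N), Function.Injective f := by
  let b := Module.finBasis k X
  refine ⟨Module.finrank k X, LinearMap.pi fun i => cofree k (b.coord i), ?_⟩
  intro x y hxy
  refine b.ext_elem fun i => ?_
  have := congrArg (fun φ => jev k φ 1) (congrFun hxy i)
  change b.coord i ((1 : A) • x) = b.coord i ((1 : A) • y) at this
  simpa using this

lemma Ret.trans_inj {X : ModuleCat.{0} A} [Module.Finite k X] (hX : Module.Injective A X) :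
    Ret (J k A) X := by
  obtain ⟨N, f, hf⟩ := exists_embed k X
  obtain ⟨g, hg⟩ := hX.out f hf LinearMap.id
  obtain ⟨M, s, r, h⟩ := JP_ret k A N
  refine ⟨M, fun i => s i ∘ₗ f, fun i => g ∘ₗ r i, fun x => ?_⟩
  simp only [LinearMap.comp_apply]
  rw [← map_sum, h]
  exact hg x

variable (Q : ModuleCat.{0} A)

/-- the comparison map `Q → D Hom(Q, J)`. -/
def toGJ : QE Q →ₗ[Module.End A Q] G k Q (J k A) where
  toFun q := ({ toFun := fun F => jev k ((show Q →ₗ[A] J k A from F) q) 1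
                map_add' := fun F F' => rfl
                map_smul' := fun c F => by
                  let F' : Q →ₗ[A] J k A := F
                  change jev k (F' (c • (show Q from q))) 1 = c * jev k (F' q) 1
                  rw [kmod_smul, map_smul, ← kmod_smul, jev_ksmul'] } : H Q (J k A) →ₗ[k] k)
  map_add' q q' := by
    refine LinearMap.ext (fun F => ?_ : ∀ F : H Q (J k A), _)
    let F' : Q →ₗ[A] J k A := F
    change jev k (F' ((show Q from q) + (show Q from q'))) 1 = jev k (F' q) 1 + jev k (F' q') 1
    rw [map_add, jev_add]
  map_smul' e q := rfl

lemma toGJ_inj : Function.Injective (toGJ k Q) := by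
  rw [injective_iff_map_eq_zero]
  intro q hq
  let q' : Q := q
  have h : ∀ μ : Module.Dual k Q, μ q' = 0 := fun μ => by
    have h1 := LinearMap.congr_fun (f := (show H Q (J k A) →ₗ[k] k from toGJ k Q q)) (g := 0) hq
      (show H Q (J k A) from cofree k μ)
    change μ ((1 : A) • q') = 0 at h1
    rwa [one_smul] at h1
  exact (Module.forall_dual_apply_eq_zero_iff k q').1 h

lemma toGJ_surj [Module.Finite k Q] : Function.Surjective (toGJ k Q) := by
  intro ψ
  let ψ' : H Q (J k A) →ₗ[k] k := ψ
  let Ψ : Module.Dual k (Module.Dual k Q) :=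
    { toFun := fun μ => ψ' (show H Q (J k A) from cofree k μ)
      map_add' := fun μ ν => by
        rw [← map_add]; rfl
      map_smul' := fun c μ => by
        have h : (show H Q (J k A) from cofree k (c • μ)) =
            c • (show H Q (J k A) from cofree k μ) := by
          refine LinearMap.ext (fun q => jext fun a => ?_ : ∀ q : Q, _)
          change c * μ (a • q) = μ (a • (c • q))
          rw [smul_comm a c q]; exact (μ.map_smul c _).symm
        rw [h, map_smul]; rfl }
  refine ⟨(Module.evalEquiv k Q).symm Ψ, ?_⟩
  refine LinearMap.ext (fun F => ?_ : ∀ F : H Q (J k A), _ = ψ' F)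
  let F' : Q →ₗ[A] J k A := F
  have h1 : (jfun k F') ((Module.evalEquiv k Q).symm Ψ) = Ψ (jfun k F') :=
    Module.apply_evalEquiv_symm_apply k Q (jfun k F') Ψ
  have h2 : Ψ (jfun k F') = ψ' (show H Q (J k A) from cofree k (jfun k F')) := rfl
  rw [h2, cofree_jfun] at h1
  exact h1

lemma G_JP_ret [Module.Finite k Q] {X : ModuleCat.{0} A} (h : Ret (J k A) X) :
    Ret (QE Q) (G k Q X) :=
  (G_ret k Q h).trans_equiv (LinearEquiv.ofBijective (toGJ k Q) ⟨toGJ_inj k Q, toGJ_surj k Q⟩).symm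

/-- The main induction. -/
lemma main_ind [Module.Finite k Q] [FiniteDimensional k A] {n : ℕ}
    (hE : ∀ i, i + 3 ≤ n → EV (QE Q) (QE Q) (i+1)) (m : ℕ) : ∀ K : ModuleCat.{0} A,
    Module.Finite k K → (∀ i, EV Q K (i+1)) → (∀ i, m ≤ i → ∀ Y, EV Y K (i+1)) → m + 2 ≤ n →
    ResLE (Module.End A Q) (QE Q) (InAdd (Module.End A Q) (QE Q)) (G k Q K) m ∧
    ∀ i, i + 3 + m ≤ n → EV (QE Q) (G k Q K) (i+1) := by
  induction m with
  | zero =>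
    intro K hK hQK hid hn
    have hinj : Module.Injective A K := EV.inj_of fun Y => hid 0 le_rfl Y
    have hr := G_JP_ret k Q (Ret.trans_inj k hinj)
    exact ⟨resLE_zero (ret_iff.2 hr), fun i hi => hr.ev (hE i (by omega))⟩
  | succ m ih =>
    intro K hK hQK hid hn
    obtain ⟨N, f, hf⟩ := exists_embed k K
    have hses := SES.coker f hf
    have hI := JP_inj k A N
    have hfin := JP_fin k A N
    have hC : Module.Finite k (ModuleCat.of A (JP k A N ⧸ LinearMap.range f)) :=
      finite_of_surj k (Y := ModuleCat.of A (JP k A N ⧸ LinearMap.range f))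
        (LinearMap.range f).mkQ (Submodule.mkQ_surjective _)
    obtain ⟨h1, h2⟩ := ih _ hC
      (fun i => EV.cov3 hses (EV.of_inj hI _) (hQK _))
      (fun i hi Y => EV.cov3 hses (EV.of_inj hI _) (hid _ (by omega) Y)) (by omega)
    have hG := GMap_ses k Q hses (hQK 0)
    have hr := G_JP_ret k Q (JP_ret k A N)
    refine ⟨resLE_succ hG (ret_iff.2 hr) (fun u => EV.lift hG (h2 0 (by omega)) u) h1, fun i hi => ?_⟩
    exact EV.cov3 hG (hr.ev (hE i (by omega))) (h2 (i+1) (by omega))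

end
end PaperAux
end Helpers6

noncomputable section Helpers7
open Paper CategoryTheory CategoryTheory.Abelian
namespace PaperAux

section
variable {A : Type} [Ring A] {Q : ModuleCat.{0} A}

/-- `Hom_E(P,E) → Hom_A(Q, Hom_E(P,Q))`. -/
def sw {P : ModuleCat.{0} (Module.End A Q)} (h : P →ₗ[Module.End A Q] Module.End A Q) :
    Q →ₗ[A] S Q P where
  toFun q := ({ toFun := fun p => h p q
                map_add' := fun p p' => by rw [map_add]; rfl
                map_smul' := fun e p => by rw [map_smul]; rfl } : P →ₗ[Module.End A Q] Q)
  map_add' q q' := LinearMap.ext (fun p => map_add (h p) q q')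
  map_smul' a q := LinearMap.ext (fun p => map_smul (h p) a q)

/-- inverse of `sw`. -/
def unsw {P : ModuleCat.{0} (Module.End A Q)} (v : Q →ₗ[A] S Q P) :
    P →ₗ[Module.End A Q] Module.End A Q where
  toFun p := { toFun := fun q => (show P →ₗ[Module.End A Q] Q from v q) p
               map_add' := fun q q' => by
                rw [map_add]; rfl
               map_smul' := fun a q => by
                rw [map_smul]; rfl }
  map_add' p p' := LinearMap.ext fun q => map_add (show P →ₗ[Module.End A Q] Q from v q) p p'
  map_smul' e p := LinearMap.ext fun q => map_smul (show P →ₗ[Module.End A Q] Q from v q) e p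

lemma sw_unsw {P : ModuleCat.{0} (Module.End A Q)} (v : Q →ₗ[A] S Q P) : sw (unsw v) = v := rfl

lemma sw_inj {P : ModuleCat.{0} (Module.End A Q)} {h h' : P →ₗ[Module.End A Q] Module.End A Q}
    (e : sw h = sw h') : h = h' :=
  LinearMap.ext fun p => LinearMap.ext fun q =>
    LinearMap.congr_fun (show (show P →ₗ[Module.End A Q] Q from sw h q) = sw h' q from
      LinearMap.congr_fun e q) p

/-- `Hom_E(P,E) → Hom_A(Q,K)`. -/
def Phi {P : ModuleCat.{0} (Module.End A Q)} {K : ModuleCat.{0} A} (π : S Q P →ₗ[A] K) :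
    (P →ₗ[Module.End A Q] Module.End A Q) →ₗ[(Module.End A Q)ᵐᵒᵖ] H Q K where
  toFun h := π ∘ₗ sw h
  map_add' h h' := LinearMap.ext fun q => map_add π (sw h q) (sw h' q)
  map_smul' _ _ := rfl

lemma tr_equiv {P1 P0 : ModuleCat.{0} (Module.End A Q)} {K : ModuleCat.{0} A}
    (g : P1 →ₗ[Module.End A Q] P0) (π : S Q P1 →ₗ[A] K)
    (h1 : ∀ u : Q →ₗ[A] K, ∃ v : Q →ₗ[A] S Q P1, π ∘ₗ v = u)
    (h2 : ∀ v : Q →ₗ[A] S Q P1, π ∘ₗ v = 0 ↔ ∃ w : Q →ₗ[A] S Q P0, sMap A Q g ∘ₗ w = v) :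
    Nonempty (((P1 →ₗ[Module.End A Q] Module.End A Q) ⧸
      LinearMap.range (lprecomp (Module.End A Q) g)) ≃ₗ[(Module.End A Q)ᵐᵒᵖ] H Q K) := by
  have hs : Function.Surjective (Phi π) := fun u => by
    obtain ⟨v, hv⟩ := h1 u
    exact ⟨unsw v, hv⟩
  have hk : LinearMap.range (lprecomp (Module.End A Q) g) = LinearMap.ker (Phi π) := by
    ext h
    constructor
    · rintro ⟨h', rfl⟩
      exact (h2 _).2 ⟨sw h', rfl⟩
    · intro hh
      obtain ⟨w, hw⟩ := (h2 (sw h)).1 hh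
      exact ⟨unsw w, sw_inj hw⟩
  exact ⟨(Submodule.quotEquivOfEq _ _ hk).trans ((Phi π).quotKerEquivOfSurjective hs)⟩

/-- `A = End_E(Q)`. -/
lemma SQ_equiv (h1 : ∀ φ : Q →ₗ[Module.End A Q] Q, ∃ a : A, ∀ q, φ q = a • q)
    (h2 : ∀ a : A, (∀ q : Q, a • q = 0) → a = 0) :
    Nonempty (S Q (QE Q) ≃ₗ[A] ModuleCat.of A A) := by
  let F : ModuleCat.of A A →ₗ[A] S Q (QE Q) :=
    { toFun := fun a => (show Q →ₗ[Module.End A Q] Q from toEndE A Q a)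
      map_add' := fun a b => (toEndE A Q).map_add a b
      map_smul' := fun a b => (toEndE A Q).map_mul a b }
  refine ⟨(LinearEquiv.ofBijective F ⟨?_, ?_⟩).symm⟩
  · rw [injective_iff_map_eq_zero]
    intro a ha
    exact h2 a fun q => LinearMap.congr_fun (f := (show Q →ₗ[Module.End A Q] Q from toEndE A Q a))
      (g := 0) ha q
  · intro φ
    obtain ⟨a, ha⟩ := h1 φ
    exact ⟨a, LinearMap.ext fun q => (ha q).symm⟩

end

section

lemma kfinite (k : Type) [Field k] {A : Type} [Ring A] [Algebra k A] [FiniteDimensional k A]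
    (Q : ModuleCat.{0} A) [Module.Finite A Q] : Module.Finite k Q := Module.Finite.trans A Q

lemma Efin (k : Type) [Field k] {A : Type} [Ring A] [Algebra k A] [FiniteDimensional k A]
    (Q : ModuleCat.{0} A) [Module.Finite A Q] : Module.Finite k (Module.End A Q) := by
  have := kfinite k Q
  let F : Module.End A Q →ₗ[k] (Q →ₗ[k] Q) :=
    { toFun := fun f => f.restrictScalars k
      map_add' := fun _ _ => rfl
      map_smul' := fun _ _ => rfl }
  exact Module.Finite.of_injective F fun f g h => LinearMap.ext fun q => LinearMap.congr_fun h q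

lemma Enoeth (k : Type) [Field k] {A : Type} [Ring A] [Algebra k A] [FiniteDimensional k A]
    (Q : ModuleCat.{0} A) [Module.Finite A Q] : IsNoetherianRing (Module.End A Q) := by
  have := Efin k Q
  exact isNoetherian_of_tower k inferInstance

lemma QEfin (k : Type) [Field k] {A : Type} [Ring A] [Algebra k A] [FiniteDimensional k A]
    (Q : ModuleCat.{0} A) [Module.Finite A Q] : Module.Finite (Module.End A Q) (QE Q) := by
  have := kfinite k Q
  have : IsScalarTower k (Module.End A Q) Q := ⟨fun _ _ _ => rfl⟩
  exact (Module.Finite.of_restrictScalars_finite k (Module.End A Q) Q :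
    Module.Finite (Module.End A Q) Q)

theorem main (k : Type) [Field k] {A : Type} [Ring A] [Algebra k A] [FiniteDimensional k A]
    (Q : ModuleCat.{0} A) [Module.Finite A Q] (n m l : ℕ)
    (hpair : IsRelAGPair A Q n) (hpd : pdLE A Q l) (hid : idLE A Q m)
    (hn : m + l + 2 ≤ n) :
    ∀ T : ModuleCat.{0} (Module.End A Q),
      IsTauN k (Module.End A Q) (n - m - 1) (QE Q) T →
      ResLE (Module.End A Q) (QE Q) (InAdd (Module.End A Q) (QE Q)) T m := by
  rintro T ⟨Z, hZ, Tr, ⟨P1, P0, g, p, hp, hP1, hex, hsup, ⟨eTr⟩⟩, ⟨eT⟩⟩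
  obtain ⟨R, -⟩ := projRes_of_pdLE hpd
  have hQ : ∀ i, EV Q Q (i+1) := fun i =>
    ev_of_extVanish R (hpair.2.2.1 (i+1) (by omega))
  have hid' : ∀ i, m ≤ i → ∀ Y, EV Y Q (i+1) := fun i hi Y => ev_of_idLE hid hi
  obtain ⟨hd1, hd2, hd3⟩ := domdim_consequences (n := n) (by omega) hpair.2.2.2
  obtain ⟨eA⟩ := SQ_equiv hd1 hd2
  have hA := Ret.of_equiv eA
  have := Enoeth k Q
  have := kfinite k Q
  have h0 : Good Q (0 + (n - m - 1 - 1)) l n (QE Q) :=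
    { fin := QEfin k Q
      extE := fun i hi => hd3 i (by omega)
      extA := fun i hi => ev_of_pdLE hpd hi
      idA := fun i hi Y => hA.ev (ev_of_idLE hpair.1 hi) }
  have h1 := Good.omega hQ hid' _ h0 (by omega) hZ
  rw [show l - (n - m - 1 - 1) = 0 by omega] at h1
  obtain ⟨K, π, hK1, hK2, hK3, hK4, hK5⟩ := exists_K hQ hid' h1 (by omega) hp hP1 hex hsup
  obtain ⟨eK⟩ := tr_equiv g π hK4 hK5
  have e1 : Tr ≃ₗ[(Module.End A Q)ᵐᵒᵖ] H Q K := eTr.trans eK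
  have e2 : G k Q K ≃ₗ[Module.End A Q] T := (DEquiv k e1).trans eT.symm
  exact resLE_equiv e2 (main_ind k Q hd3 m K (kfinite k K) hK2 hK3 (by omega)).1

end
end PaperAux
end Helpers7


noncomputable section Statement8
open Paper

/-- Lemma 3.4: for a relative `n`-Auslander–Gorenstein pair `(A, Q)`
with `pd_A Q = l`, `id_A Q = m` and `n ≥ m + l + 2`, there is an exact sequence
`0 → Q_m → ⋯ → Q_0 → τ_{n−m−1}(Q) → 0` of right `Λ`-modules (`Λ = End_A(Q)^op`,
i.e. left `End_A(Q)`-modules) with terms in `add Q` remaining exact under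
`Hom_Λ(Q, −)`. -/
theorem stmt8 (k : Type) [Field k] (A : Type) [Ring A] [Algebra k A] [FiniteDimensional k A]
    (Q : ModuleCat.{0} A) [Module.Finite A Q] (n m l : ℕ)
    (hpair : IsRelAGPair A Q n) (hpd : pdEq A Q l) (hid : idEq A Q m)
    (hn : m + l + 2 ≤ n) :
    ∀ T : ModuleCat.{0} (Module.End A Q),
      IsTauN k (Module.End A Q) (n - m - 1) (ModuleCat.of (Module.End A Q) Q) T →
      RelAddDimLE (Module.End A Q) (ModuleCat.of (Module.End A Q) Q) T m := by
  exact PaperAux.main k Q n m l hpair hpd.1 hid.1 hn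

end Statement8
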